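/- Let k be an integer such that either 5 ≤ k ≤ 10, or k ≥ 5 and neither k nor k − 2 is a perfect square. Then there is no symmetric configuration (k² − k + 2)_k; that is, there is no (k² − k + 2)×(k² − k + 2) 0,1-matrix with exactly k ones in every row and column and no 2×2 all-ones submatrix. -/

import Mathlib

/-- A 0,1-matrix (given as a `Bool`-valued function) contains no 2×2 all-ones
submatrix: there are no two distinct row indices and two distinct column
indices such that all four corresponding entries are 1. -/
def NoRect {α β : Type*} (M : α → β → Bool) : Prop :=
  ∀ i₁ i₂ j₁ j₂, i₁ ≠ i₂ → j₁ ≠ j₂ →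
    M i₁ j₁ = true → M i₁ j₂ = true → M i₂ j₁ = true → M i₂ j₂ = true → False

/-- `M` is an incidence matrix of a symmetric configuration with parameter `k`:
every row and every column contains exactly `k` ones, and there is no
2×2 all-ones submatrix. -/
def IsIncidence {α β : Type*} [Fintype α] [Fintype β]
    (k : ℕ) (M : α → β → Bool) : Prop :=
  (∀ i : α, (Finset.univ.filter (fun j => M i j = true)).card = k) ∧
  (∀ j : β, (Finset.univ.filter (fun i => M i j = true)).card = k) ∧
  NoRect M

/-- A symmetric configuration `v_k` exists: there is a `v × v` 0,1-matrix with
exactly `k` ones in every row and column and no 2×2 all-ones submatrix. -/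
def ConfigExists (v k : ℕ) : Prop :=
  ∃ M : Fin v → Fin v → Bool, IsIncidence k M

/-- `A` is a `(v,k)` modular Golomb ruler: a `k`-element subset of `ℤ/vℤ`
such that all differences `a - a'` with `a ≠ a'` in `A` are nonzero and
pairwise distinct. -/
def IsModularGolombRuler (v k : ℕ) (A : Finset (ZMod v)) : Prop :=
  A.card = k ∧
  (∀ a ∈ A, ∀ a' ∈ A, a ≠ a' → a - a' ≠ 0) ∧
  (∀ a ∈ A, ∀ a' ∈ A, ∀ b ∈ A, ∀ b' ∈ A, a ≠ a' → b ≠ b' →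
    a - a' = b - b' → a = b ∧ a' = b')

/-- `a` is a Golomb ruler of order `k`: `k` nonnegative integers in strictly
increasing order all of whose differences `a i - a j` with `i ≠ j` are
pairwise distinct. -/
def IsGolombRuler (k : ℕ) (a : Fin k → ℤ) : Prop :=
  (∀ i, 0 ≤ a i) ∧ StrictMono a ∧
  (∀ i j i' j' : Fin k, i ≠ j → i' ≠ j' → a i - a j = a i' - a j' → i = i' ∧ j = j')

/-- A row of candidate cells: value, bit of the cell, mask of consequences. -/
inductive CRow where
  | nil : CRow
  | cons (v b U : Nat) (tl : CRow) : CRow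

/-- apply `f` to `n`, making the kernel evaluate `n` first -/
noncomputable def nforce {α : Type} (n : Nat) (f : Nat → α) : α :=
  Nat.rec (f 0) (fun m _ => f (Nat.succ m)) n

noncomputable def lforce {α : Type} (l : List Nat) : (List Nat → α) → α :=
  List.rec (fun f => f []) (fun x _ ih f => nforce x (fun y => ih (fun ys => f (y :: ys)))) l

/-- depth first search for all permutations compatible with the table -/
noncomputable def dfs (full : Nat) (rows : List CRow) :
    Nat → List Nat → List (List Nat) → List (List Nat) :=
  List.rec
    (fun F pre acc => Bool.rec acc (pre :: acc) (Nat.beq (Nat.land full F) full))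
    (fun row _ ih F pre acc =>
      nforce F fun F =>
      CRow.rec acc
        (fun v b U _ ih' =>
          Nat.rec (ih (Nat.lor F U) (v :: pre) ih') (fun _ _ => ih') (Nat.land F b)) row)
    rows

/-- remove from a row the cells forbidden by `F` -/
noncomputable def rfilt {α : Type} (F : Nat) (row : CRow) : (CRow → α) → α :=
  CRow.rec (fun f => f CRow.nil)
    (fun v b U _ ih f =>
      Nat.rec (ih fun r => f (CRow.cons v b U r)) (fun _ _ => ih f) (Nat.land F b)) row

/-- consequence mask of the cell with value `v` -/
noncomputable def rget (v : Nat) (row : CRow) : Nat :=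
  CRow.rec 0 (fun v' _ U _ ih => Bool.rec ih U (Nat.beq v v')) row

noncomputable def rnth (l : List CRow) : Nat → CRow :=
  List.rec (fun _ => CRow.nil) (fun x _ ih n => Nat.rec x (fun m _ => ih m) n) l

/-- all candidate rows, with positions `i`, `k` fixed to `j`, `l`. -/
noncomputable def mkRows {α : Type} (F i j u1 k l u2 : Nat) (rows : List CRow) :
    Nat → (List CRow → α) → α :=
  List.rec (fun _ f => f [])
    (fun row _ ih p f => nforce p fun p => ih (Nat.succ p) fun rs =>
      Bool.rec
        (Bool.rec (rfilt F row fun r => f (r :: rs))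
          (f (CRow.cons l 0 u2 CRow.nil :: rs)) (Nat.beq p k))
        (f (CRow.cons j 0 u1 CRow.nil :: rs)) (Nat.beq p i)) rows

/-- add the mask `T` to the cell with value `v` -/
noncomputable def rmod {α : Type} (v T : Nat) (row : CRow) : (CRow → α) → α :=
  CRow.rec (fun f => f CRow.nil)
    (fun v' b U tl ih f =>
      Bool.rec (ih fun r => f (CRow.cons v' b U r))
        (nforce (Nat.lor U T) fun u => f (CRow.cons v' b u tl)) (Nat.beq v v')) row

noncomputable def radd {α : Type} (T : Nat) (rows : List CRow) :
    List Nat → (List CRow → α) → α :=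
  List.rec (fun _ f => f [])
    (fun row _ ih s f => List.rec (f [])
      (fun v vs _ => rmod v T row fun r => ih vs fun rs => f (r :: rs)) s) rows

/-- mask of a permutation -/
noncomputable def pmask (K : Nat) (s : List Nat) : Nat → Nat :=
  List.rec (fun _ => 0)
    (fun v _ ih p => Nat.lor (Nat.pow 2 (Nat.add (Nat.mul K p) v)) (ih (Nat.succ p))) s

noncomputable def lidx (v : Nat) (s : List Nat) : Nat :=
  List.rec 0 (fun x _ ih => Bool.rec (Nat.succ ih) 0 (Nat.beq x v)) s

noncomputable def linv (s : List Nat) : Nat → Nat → List Nat :=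
  Nat.rec (fun _ => []) (fun _ ih v => lidx v s :: ih (Nat.succ v))

noncomputable def lrev (s : List Nat) : List Nat → List Nat :=
  List.rec (fun acc => acc) (fun x _ ih acc => ih (x :: acc)) s

structure CState where
  rows : List CRow
  full : Nat
  hit : Nat

/-- add the permutation `s` (with its inverse) to the state -/
noncomputable def cadd {α : Type} (K : Nat) (st : CState) (s : List Nat) (f : CState → α) : α :=
  lforce (linv s K 0) fun t =>
  nforce (Nat.lor st.hit (pmask K s 0)) fun T1 =>
  nforce (Nat.lor (Nat.mul 2 st.hit) (pmask K t 0)) fun T2 =>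
  radd T1 st.rows s fun r1 =>
  radd T2 r1 t fun r2 =>
  nforce (Nat.lor st.full (Nat.mul 3 st.hit)) fun fu =>
  nforce (Nat.mul 4 st.hit) fun h => f ⟨r2, fu, h⟩

noncomputable def csols (st : CState) (i j k l : Nat) : List (List Nat) :=
  nforce (rget j (rnth st.rows i)) fun u1 =>
  nforce (rget l (rnth st.rows k)) fun u2 =>
  nforce (Nat.lor u1 u2) fun F =>
  mkRows F i j u1 k l u2 st.rows 0 fun rs => dfs st.full rs F [] []

noncomputable def cvalid (K : Nat) (st : CState) (i j k l : Nat) : Bool :=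
  not (Nat.beq i j) && not (Nat.beq k l) && not (Nat.beq i k) && not (Nat.beq j l) &&
  not (Nat.beq k j && Nat.beq l i) &&
  Nat.beq (Nat.shiftRight (Nat.land (rget j (rnth st.rows i)) (rget l (rnth st.rows k)))
    (Nat.mul K K)) 0

noncomputable def cloop (ok : List Nat → Bool) (g : List Nat → Nat → Option Nat)
    (sols : List (List Nat)) : Nat → Option Nat :=
  List.rec (fun cs => some cs)
    (fun s _ ih cs =>
      lforce (lrev s []) fun s' =>
      Bool.rec (ih cs) (Option.rec none (fun cs' => ih cs') (g s' cs)) (ok s')) sols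

noncomputable def check (K : Nat) (ok : List Nat → Bool) (fuel : Nat) :
    CState → Nat → Option Nat :=
  Nat.rec (fun _ _ => none)
    (fun _ ih st cs =>
        nforce (Nat.mod cs K) fun l =>
        nforce (Nat.mod (Nat.div cs K) K) fun k =>
        nforce (Nat.mod (Nat.div cs (Nat.mul K K)) K) fun j =>
        nforce (Nat.mod (Nat.div cs (Nat.mul K (Nat.mul K K))) K) fun i =>
        nforce (Nat.div cs (Nat.mul (Nat.mul K K) (Nat.mul K K))) fun cs' =>
        Bool.rec none
          (cloop ok (fun s cs'' => cadd K st s (fun st' => ih st' cs'')) (csols st i j k l) cs')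
          (cvalid K st i j k l)) fuel

/-- initial table -/
noncomputable def ustart (K : Nat) (p v : Nat) : Nat :=
  Nat.lor (Nat.pow 2 (Nat.add (Nat.mul K v) p))
    (Nat.rec 0 (fun q ih => Nat.lor (Nat.pow 2 (Nat.add (Nat.mul K q) v)) ih) K)

noncomputable def rowOf (K p : Nat) (g : Nat → Nat) : Nat → CRow :=
  Nat.rec CRow.nil (fun v ih =>
    Bool.rec (CRow.cons v (Nat.pow 2 (Nat.add (Nat.mul K p) v)) (g v) ih) ih (Nat.beq p v))

noncomputable def rforce {α : Type} (row : CRow) : (CRow → α) → α :=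
  CRow.rec (fun f => f CRow.nil)
    (fun v b U _ ih f => nforce v fun v => nforce b fun b => nforce U fun U =>
      ih fun r => f (CRow.cons v b U r)) row

noncomputable def tstart {α : Type} (K : Nat) : Nat → List CRow → (List CRow → α) → α :=
  Nat.rec (fun rs f => f rs)
    (fun p ih rs f => rforce (rowOf K p (ustart K p) K) fun r => ih (r :: rs) f)


noncomputable def ldrop (sols : List (List Nat)) : Nat → List (List Nat) :=
  List.rec (fun _ => []) (fun x xs ih n => Nat.rec (x :: xs) (fun m _ => ih m) n) sols

noncomputable def ltake (sols : List (List Nat)) : Nat → List (List Nat) :=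
  List.rec (fun _ => []) (fun x _ ih n => Nat.rec [] (fun m _ => x :: ih m) n) sols

/-- root state containing the permutation `s` -/
noncomputable def rootState {α : Type} (K : Nat) (s : List Nat) (f : CState → α) : α :=
  tstart K K [] fun r => cadd K ⟨r, 0, Nat.pow 2 (Nat.mul K K)⟩ s f

/-- check the part `a, ..., a + n - 1` of the solutions at the root (everything from `a` on
if `n = 0`) -/
noncomputable def crun (K : Nat) (ok : List Nat → Bool) (s : List Nat) (i j k l a n cert : Nat) :
    Bool :=
  rootState K s fun st => Bool.rec false
    (Option.rec false (fun _ => true)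
      (cloop ok (fun s' cs => cadd K st s' (fun st' => check K ok 9 st' cs))
        (Bool.rec (ltake (ldrop (csols st i j k l) a) n) (ldrop (csols st i j k l) a)
          (Nat.beq n 0)) cert))
    (cvalid K st i j k l)

theorem nforce_eq {α : Type} (n : Nat) (f : Nat → α) : nforce n f = f n := by
  cases n <;> rfl

theorem lforce_eq {α : Type} (l : List Nat) (f : List Nat → α) : lforce l f = f l := by
  induction l generalizing f with
  | nil => rfl
  | cons x xs ih =>
    change nforce x (fun y => lforce xs (fun ys => f (y :: ys))) = _
    rw [nforce_eq, ih]

/-- membership of a cell in a row -/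
def RMem (v b U : Nat) : CRow → Prop
  | CRow.nil => False
  | CRow.cons v' b' U' tl => (v = v' ∧ b = b' ∧ U = U') ∨ RMem v b U tl

theorem natrec_ite {α : Type} (x y : α) (n : Nat) :
    (Nat.rec x (fun _ _ => y) n : α) = if n = 0 then x else y := by
  cases n <;> simp

theorem boolrec_ite {α : Type} (x y : α) (b : Bool) :
    (Bool.rec x y b : α) = if b = true then y else x := by
  cases b <;> simp

theorem dfs_nil (full F : Nat) (pre : List Nat) (acc : List (List Nat)) :
    dfs full [] F pre acc = if full &&& F = full then pre :: acc else acc := by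
  change (Bool.rec acc (pre :: acc) (Nat.beq (Nat.land full F) full) : List (List Nat)) = _
  rw [boolrec_ite]
  simp only [Nat.beq_eq]
  rfl

/-- the inner loop of `dfs` -/
noncomputable def dfsRow (full F : Nat) (rows : List CRow) (pre : List Nat)
    (acc : List (List Nat)) : CRow → List (List Nat)
  | CRow.nil => acc
  | CRow.cons v b U tl =>
    if F &&& b = 0 then dfs full rows (F ||| U) (v :: pre) (dfsRow full F rows pre acc tl)
    else dfsRow full F rows pre acc tl

theorem dfs_cons (full F : Nat) (row : CRow) (rows : List CRow) (pre : List Nat)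
    (acc : List (List Nat)) :
    dfs full (row :: rows) F pre acc = dfsRow full F rows pre acc row := by
  change nforce F (fun F => (CRow.rec acc
        (fun v b U _ ih' =>
          Nat.rec (dfs full rows (Nat.lor F U) (v :: pre) ih') (fun _ _ => ih') (Nat.land F b)) row
          : List (List Nat))) = _
  rw [nforce_eq]
  induction row with
  | nil => rfl
  | cons v b U tl ih =>
    simp only [dfsRow]
    rw [← ih, natrec_ite]
    rfl

theorem dfs_acc (full : Nat) (rows : List CRow) (F : Nat) (pre : List Nat)
    (acc : List (List Nat)) (x : List Nat) (hx : x ∈ acc) : x ∈ dfs full rows F pre acc := by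
  induction rows generalizing F pre acc with
  | nil => rw [dfs_nil]; split <;> simp [hx]
  | cons row rows ih =>
    rw [dfs_cons]
    induction row with
    | nil => exact hx
    | cons v b U tl ih' =>
      simp only [dfsRow]
      split
      · exact ih _ _ _ ih'
      · exact ih'

/-- The choice `cl` of cells is compatible with the search. -/
def Compat (full : Nat) : Nat → List (Nat × Nat × Nat) → Prop
  | F, [] => full &&& F = full
  | F, c :: cl => F &&& c.2.1 = 0 ∧ Compat full (F ||| c.2.2) cl

theorem dfs_complete (full : Nat) (rows : List CRow) (cl : List (Nat × Nat × Nat))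
    (h : List.Forall₂ (fun c row => RMem c.1 c.2.1 c.2.2 row) cl rows) (F : Nat) (pre : List Nat)
    (acc : List (List Nat)) (hc : Compat full F cl) :
    (cl.map Prod.fst).reverse ++ pre ∈ dfs full rows F pre acc := by
  induction h generalizing F pre acc with
  | nil => simp only [Compat] at hc; rw [dfs_nil]; simp [hc]
  | @cons c row cl rows hm h ih =>
    obtain ⟨h1, h2⟩ := hc
    rw [dfs_cons]
    induction row with
    | nil => exact hm.elim
    | cons v b U tl ih' =>
      simp only [dfsRow]
      rcases hm with ⟨rfl, rfl, rfl⟩ | hm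
      · rw [if_pos h1]
        simpa using ih (F ||| c.2.2) (c.1 :: pre) _ h2
      · split
        · exact dfs_acc _ _ _ _ _ _ (ih' hm)
        · exact ih' hm

/-- plain filter of a row -/
def rfilt' (F : Nat) : CRow → CRow
  | CRow.nil => CRow.nil
  | CRow.cons v b U tl => if F &&& b = 0 then CRow.cons v b U (rfilt' F tl) else rfilt' F tl

theorem rfilt_eq {α : Type} (F : Nat) (row : CRow) (f : CRow → α) :
    rfilt F row f = f (rfilt' F row) := by
  induction row generalizing f with
  | nil => rfl
  | cons v b U tl ih =>
    change (Nat.rec (rfilt F tl fun r => f (CRow.cons v b U r)) (fun _ _ => rfilt F tl f)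
      (Nat.land F b) : α) = _
    rw [natrec_ite, ih, ih, rfilt']
    change (if F &&& b = 0 then _ else _) = _
    split <;> rfl

theorem rmem_rfilt (F v b U : Nat) (row : CRow) (h : RMem v b U row) (hb : F &&& b = 0) :
    RMem v b U (rfilt' F row) := by
  induction row with
  | nil => exact h.elim
  | cons v' b' U' tl ih =>
    simp only [rfilt']
    rcases h with ⟨rfl, rfl, rfl⟩ | h
    · rw [if_pos hb]; exact Or.inl ⟨rfl, rfl, rfl⟩
    · split
      · exact Or.inr (ih h)
      · exact ih h

theorem rowOf_succ (K p : Nat) (g : Nat → Nat) (n : Nat) :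
    rowOf K p g (n + 1) = if p = n then rowOf K p g n
      else CRow.cons n (2 ^ (K * p + n)) (g n) (rowOf K p g n) := by
  change (Bool.rec (CRow.cons n (Nat.pow 2 (Nat.add (Nat.mul K p) n)) (g n) (rowOf K p g n))
    (rowOf K p g n) (Nat.beq p n) : CRow) = _
  rw [boolrec_ite]
  simp only [Nat.beq_eq]
  rfl

theorem rmem_rowOf (K p : Nat) (g : Nat → Nat) (n v : Nat) (hv : v < n) (hp : v ≠ p) :
    RMem v (2 ^ (K * p + v)) (g v) (rowOf K p g n) := by
  induction n with
  | zero => omega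
  | succ n ih =>
    rw [rowOf_succ]
    by_cases hvn : v = n
    · subst hvn
      rw [if_neg (Ne.symm hp)]
      exact Or.inl ⟨rfl, rfl, rfl⟩
    · have := ih (by omega)
      split
      · exact this
      · exact Or.inr this

theorem rget_rowOf (K p : Nat) (g : Nat → Nat) (n v : Nat) (hv : v < n) (hp : v ≠ p) :
    rget v (rowOf K p g n) = g v := by
  induction n with
  | zero => omega
  | succ n ih =>
    rw [rowOf_succ]
    by_cases hvn : v = n
    · subst hvn
      rw [if_neg (Ne.symm hp)]
      change (Bool.rec _ (g v) (Nat.beq v v) : Nat) = _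
      rw [boolrec_ite]
      simp
    · have := ih (by omega)
      split
      · exact this
      · change (Bool.rec (rget v (rowOf K p g n)) (g n) (Nat.beq v n) : Nat) = _
        rw [boolrec_ite]
        simp [hvn, this]

/-- plain version of `rmod` -/
def rmod' (v T : Nat) : CRow → CRow
  | CRow.nil => CRow.nil
  | CRow.cons v' b U tl => if v = v' then CRow.cons v' b (U ||| T) tl
      else CRow.cons v' b U (rmod' v T tl)

theorem rmod_eq {α : Type} (v T : Nat) (row : CRow) (f : CRow → α) :
    rmod v T row f = f (rmod' v T row) := by
  induction row generalizing f with
  | nil => rfl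
  | cons v' b U tl ih =>
    change (Bool.rec (rmod v T tl fun r => f (CRow.cons v' b U r))
        (nforce (Nat.lor U T) fun u => f (CRow.cons v' b u tl)) (Nat.beq v v') : α) = _
    rw [boolrec_ite, ih, nforce_eq, rmod']
    simp only [Nat.beq_eq]
    split <;> rfl

theorem rowOf_congr (K p : Nat) (g h : Nat → Nat) (n : Nat) (hgh : ∀ v < n, g v = h v) :
    rowOf K p g n = rowOf K p h n := by
  induction n with
  | zero => rfl
  | succ n ih =>
    rw [rowOf_succ, rowOf_succ, ih (fun v hv => hgh v (by omega)), hgh n (by omega)]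

theorem rmod_rowOf (K p : Nat) (g : Nat → Nat) (n v T : Nat) (hv : v < n) (hp : v ≠ p) :
    rmod' v T (rowOf K p g n) = rowOf K p (fun w => if w = v then g w ||| T else g w) n := by
  induction n with
  | zero => omega
  | succ n ih =>
    rw [rowOf_succ, rowOf_succ]
    by_cases hvn : v = n
    · subst hvn
      rw [if_neg (Ne.symm hp), if_neg (Ne.symm hp), rmod', if_pos rfl, if_pos rfl]
      congr 1
      exact rowOf_congr _ _ _ _ _ (fun w hw => by simp [show w ≠ v by omega])
    · have := ih (by omega)
      split
      · exact this
      · rw [rmod', if_neg hvn, this, if_neg (Ne.symm hvn)]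

theorem radd_eq {α : Type} (T : Nat) (rows : List CRow) (s : List Nat) (f : List CRow → α) :
    radd T rows s f = f (List.zipWith (fun row v => rmod' v T row) rows s) := by
  induction rows generalizing s f with
  | nil => rfl
  | cons row rows ih =>
    cases s with
    | nil => rfl
    | cons v vs =>
      change rmod v T row (fun r => radd T rows vs fun rs => f (r :: rs)) = _
      rw [rmod_eq, ih]
      rfl

/-- the table of rows given by the function `T` -/
noncomputable def tbl (K : Nat) (T : Nat → Nat → Nat) : List CRow :=
  (List.range K).map fun p => rowOf K p (T p) K

theorem zipWith_tbl (K : Nat) (T : Nat → Nat → Nat) (M : Nat) (s : Nat → Nat)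
    (hs : ∀ p < K, s p < K ∧ s p ≠ p) :
    List.zipWith (fun row v => rmod' v M row) (tbl K T) ((List.range K).map s) =
      tbl K (fun p w => if w = s p then T p w ||| M else T p w) := by
  rw [tbl, List.zipWith_map, tbl, List.zipWith_self]
  apply List.map_congr_left
  intro p hp
  rw [List.mem_range] at hp
  exact rmod_rowOf _ _ _ _ _ _ (hs p hp).1 (hs p hp).2

theorem rnth_eq (l : List CRow) (n : Nat) : rnth l n = l.getD n CRow.nil := by
  induction l generalizing n with
  | nil => rfl
  | cons x xs ih =>
    cases n with
    | zero => rfl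
    | succ n => exact ih n

theorem rnth_tbl (K : Nat) (T : Nat → Nat → Nat) (p : Nat) (hp : p < K) :
    rnth (tbl K T) p = rowOf K p (T p) K := by
  rw [rnth_eq, tbl]
  simp [List.getD, hp]

theorem rforce_eq {α : Type} (row : CRow) (f : CRow → α) : rforce row f = f row := by
  induction row generalizing f with
  | nil => rfl
  | cons v b U tl ih =>
    change nforce v (fun v => nforce b fun b => nforce U fun U =>
      rforce tl fun r => f (CRow.cons v b U r)) = _
    rw [nforce_eq, nforce_eq, nforce_eq, ih]

theorem tstart_eq {α : Type} (K n : Nat) (rs : List CRow) (f : List CRow → α) :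
    tstart K n rs f = f ((List.range n).map (fun p => rowOf K p (ustart K p) K) ++ rs) := by
  induction n generalizing rs with
  | zero => rfl
  | succ n ih =>
    change rforce (rowOf K n (ustart K n) K) (fun r => tstart K n (r :: rs) f) = _
    rw [rforce_eq, ih, List.range_succ]
    simp

/-- plain version of `mkRows` -/
noncomputable def mkRow' (F i j u1 k l u2 p : Nat) (row : CRow) : CRow :=
  if p = i then CRow.cons j 0 u1 CRow.nil
  else if p = k then CRow.cons l 0 u2 CRow.nil else rfilt' F row

theorem mkRows_eq {α : Type} (F i j u1 k l u2 : Nat) (g : Nat → CRow) (n p : Nat)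
    (f : List CRow → α) :
    mkRows F i j u1 k l u2 ((List.range' p n).map g) p f =
      f ((List.range' p n).map (fun q => mkRow' F i j u1 k l u2 q (g q))) := by
  induction n generalizing p f with
  | zero => rfl
  | succ n ih =>
    rw [List.range'_succ, List.map_cons, List.map_cons]
    change nforce p (fun p' => mkRows F i j u1 k l u2 ((List.range' (p + 1) n).map g) (Nat.succ p')
      fun rs => (Bool.rec
        (Bool.rec (rfilt F (g p) fun r => f (r :: rs))
          (f (CRow.cons l 0 u2 CRow.nil :: rs)) (Nat.beq p' k) : α)
        (f (CRow.cons j 0 u1 CRow.nil :: rs)) (Nat.beq p' i) : α)) = _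
    rw [nforce_eq, ih, boolrec_ite, boolrec_ite, rfilt_eq, mkRow']
    simp only [Nat.beq_eq]
    split_ifs <;> rfl

theorem lidx_eq (v : Nat) (s : List Nat) : lidx v s = s.idxOf v := by
  induction s with
  | nil => rfl
  | cons x xs ih =>
    change (Bool.rec (Nat.succ (lidx v xs)) 0 (Nat.beq x v) : Nat) = _
    rw [boolrec_ite, List.idxOf_cons, ih]
    by_cases h : x = v <;> simp [h, beq_eq_false_iff_ne.mpr]

theorem linv_eq (s : List Nat) (n v : Nat) :
    linv s n v = (List.range' v n).map (fun w => lidx w s) := by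
  induction n generalizing v with
  | zero => rfl
  | succ n ih =>
    rw [List.range'_succ, List.map_cons, ← ih]
    rfl

theorem lrev_eq (s acc : List Nat) : lrev s acc = s.reverse ++ acc := by
  induction s generalizing acc with
  | nil => rfl
  | cons x xs ih =>
    change lrev xs (x :: acc) = _
    rw [ih]; simp

theorem ldrop_eq (s : List (List Nat)) (n : Nat) : ldrop s n = s.drop n := by
  induction s generalizing n with
  | nil => simp [ldrop]
  | cons x xs ih =>
    cases n with
    | zero => rfl
    | succ n => exact ih n

theorem ltake_eq (s : List (List Nat)) (n : Nat) : ltake s n = s.take n := by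
  induction s generalizing n with
  | nil => simp [ltake]
  | cons x xs ih =>
    cases n with
    | zero => rfl
    | succ n => rw [List.take_succ_cons, ← ih]; rfl

theorem pmask_testBit (K : Nat) (g : Nat → Nat) (n p q w : Nat) (hg : ∀ r, g r < K) (hw : w < K) :
    (pmask K ((List.range' p n).map g) p).testBit (K * q + w) = true ↔
      (p ≤ q ∧ q < p + n ∧ g q = w) := by
  induction n generalizing p with
  | zero => simp [pmask]; omega
  | succ n ih =>
    rw [List.range'_succ, List.map_cons]
    change (2 ^ (K * p + g p) ||| pmask K ((List.range' (p + 1) n).map g) (p + 1)).testBit _ = true ↔ _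
    rw [Nat.testBit_or, Bool.or_eq_true, ih, Nat.testBit_two_pow]
    have key : K * p + g p = K * q + w ↔ p = q ∧ g p = w := by
      constructor
      · intro h
        have h1 : (K * p + g p) / K = (K * q + w) / K := by rw [h]
        have h2 : (K * p + g p) % K = (K * q + w) % K := by rw [h]
        have hK : 0 < K := by omega
        rw [Nat.mul_add_div hK, Nat.mul_add_div hK, Nat.div_eq_of_lt (hg p),
          Nat.div_eq_of_lt hw] at h1
        rw [Nat.mul_add_mod, Nat.mul_add_mod, Nat.mod_eq_of_lt (hg p), Nat.mod_eq_of_lt hw] at h2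
        exact ⟨by omega, h2⟩
      · rintro ⟨rfl, rfl⟩; rfl
    rw [decide_eq_true_iff, key]
    constructor
    · rintro (⟨rfl, h⟩ | ⟨h1, h2, h3⟩)
      · exact ⟨le_rfl, by omega, h⟩
      · exact ⟨by omega, by omega, h3⟩
    · rintro ⟨h1, h2, h3⟩
      by_cases hpq : p = q
      · subst hpq; exact Or.inl ⟨rfl, h3⟩
      · exact Or.inr ⟨by omega, by omega, h3⟩

theorem ustart_testBit (K p v q w : Nat) (hp : p < K) (hv : v < K) (hw : w < K) (hq : q < K)
    (h1 : w ≠ v) (h2 : ¬ (q = v ∧ w = p)) : (ustart K p v).testBit (K * q + w) = false := by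
  have hK : 0 < K := by omega
  have key : ∀ a b c d : Nat, b < K → d < K → K * a + b = K * c + d → a = c ∧ b = d := by
    intro a b c d hb hd h
    have e1 : (K * a + b) / K = (K * c + d) / K := by rw [h]
    have e2 : (K * a + b) % K = (K * c + d) % K := by rw [h]
    rw [Nat.mul_add_div hK, Nat.mul_add_div hK, Nat.div_eq_of_lt hb, Nat.div_eq_of_lt hd] at e1
    rw [Nat.mul_add_mod, Nat.mul_add_mod, Nat.mod_eq_of_lt hb, Nat.mod_eq_of_lt hd] at e2
    exact ⟨by omega, e2⟩
  have h3 : ∀ n : Nat, (Nat.rec 0 (fun q ih => Nat.lor (Nat.pow 2 (Nat.add (Nat.mul K q) v)) ih) n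
      : Nat).testBit (K * q + w) = false := by
    intro n
    induction n with
    | zero => simp
    | succ n ih =>
      change (2 ^ (K * n + v) ||| _).testBit _ = false
      rw [Nat.testBit_or, ih, Nat.testBit_two_pow, Bool.or_false, decide_eq_false_iff_not]
      intro h
      exact h1 (key _ _ _ _ hv hw h).2.symm
  change (2 ^ (K * v + p) ||| _).testBit _ = false
  rw [Nat.testBit_or, h3, Nat.testBit_two_pow, Bool.or_false, decide_eq_false_iff_not]
  intro h
  obtain ⟨rfl, rfl⟩ := key _ _ _ _ hp hw h
  exact h2 ⟨rfl, rfl⟩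

/-- The properties of the set of permutations attached to a line of a configuration. -/
structure GoodS (K : ℕ) (S : Set (Equiv.Perm (Fin K))) : Prop where
  inv : ∀ σ ∈ S, σ⁻¹ ∈ S
  ne : ∀ σ ∈ S, ∀ i, σ i ≠ i
  ne2 : ∀ σ ∈ S, ∀ i, σ (σ i) ≠ i
  agree : ∀ σ ∈ S, ∀ τ ∈ S, σ ≠ τ → σ ≠ τ⁻¹ → ∃ i, σ i = τ i
  uniq : ∀ σ ∈ S, ∀ τ ∈ S, ∀ i j, σ ≠ τ → σ i = τ i → σ j = τ j → i = j
  ex : ∀ i j k l, i ≠ k → j ≠ l → i ≠ j → k ≠ l → ¬ (k = j ∧ l = i) →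
    ∃ σ ∈ S, σ i = j ∧ σ k = l

/-- values of a permutation as a function on the naturals -/
def sv {K : ℕ} (σ : Equiv.Perm (Fin K)) (p : ℕ) : ℕ := if h : p < K then (σ ⟨p, h⟩ : ℕ) else 0

theorem sv_lt {K : ℕ} (hK : 0 < K) (σ : Equiv.Perm (Fin K)) (p : ℕ) : sv σ p < K := by
  unfold sv; split
  · exact Fin.isLt _
  · exact hK

theorem sv_val {K : ℕ} (σ : Equiv.Perm (Fin K)) (p : Fin K) : sv σ p = (σ p : ℕ) := by
  simp [sv]

/-- list of values -/
def vals {K : ℕ} (σ : Equiv.Perm (Fin K)) : List ℕ := (List.range K).map (sv σ)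

theorem sv_inj {K : ℕ} (σ : Equiv.Perm (Fin K)) (p q : ℕ) (hp : p < K) (hq : q < K)
    (h : sv σ p = sv σ q) : p = q := by
  simpa [sv, hp, hq, Fin.val_inj] using h

theorem linv_vals {K : ℕ} (σ : Equiv.Perm (Fin K)) : linv (vals σ) K 0 = vals σ⁻¹ := by
  rw [linv_eq, ← List.range_eq_range', vals, vals]
  apply List.map_congr_left
  intro v hv
  rw [List.mem_range] at hv
  rw [lidx_eq]
  have hnd : ((List.range K).map (sv σ)).Nodup := by
    rw [List.nodup_map_iff_inj_on List.nodup_range]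
    intro p hp q hq h
    exact sv_inj σ p q (List.mem_range.1 hp) (List.mem_range.1 hq) h
  have hlt : sv σ⁻¹ v < K := sv_lt (by omega) _ _
  have hval : sv σ (sv σ⁻¹ v) = v := by
    simp [sv, hv]
  have := hnd.idxOf_getElem (sv σ⁻¹ v) (by simpa using hlt)
  simpa [hval] using this

/-- The invariant of the search: `T` is the table of masks. -/
structure CInv {K : ℕ} (S : Set (Equiv.Perm (Fin K))) (T : ℕ → ℕ → ℕ) (st : CState) : Prop where
  rows : st.rows = tbl K T
  hit : ∃ n, K * K ≤ n ∧ st.hit = 2 ^ n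
  perm : ∀ σ ∈ S, (∃ n, K * K ≤ n ∧ ∀ p < K, (T p (sv σ p)).testBit n = true) ∨
    ((∀ p < K, ∀ q < K, p ≠ q → (T q (sv σ q)).testBit (K * p + sv σ p) = false) ∧
      ∀ n, st.full.testBit n = true → ∃ p < K, (T p (sv σ p)).testBit n = true)

theorem and_two_pow_eq_zero (F m : ℕ) (h : F.testBit m = false) : F &&& 2 ^ m = 0 := by
  rw [Nat.and_two_pow, h]; simp

theorem compat_of (full : ℕ) (cl : List (ℕ × ℕ × ℕ)) (F : ℕ)
    (h1 : ∀ c ∈ cl, F &&& c.2.1 = 0)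
    (h2 : cl.Pairwise (fun c d => c.2.2 &&& d.2.1 = 0))
    (h3 : ∀ n, full.testBit n = true → F.testBit n = true ∨ ∃ c ∈ cl, c.2.2.testBit n = true) :
    Compat full F cl := by
  induction cl generalizing F with
  | nil =>
    simp only [Compat]
    apply Nat.eq_of_testBit_eq
    intro n
    rw [Nat.testBit_and]
    cases hn : full.testBit n
    · rfl
    · simpa using h3 n hn
  | cons c cl ih =>
    rw [List.pairwise_cons] at h2
    refine ⟨h1 c (by simp), ih _ ?_ h2.2 ?_⟩
    · intro d hd
      rw [Nat.and_or_distrib_right, h1 d (by simp [hd]), h2.1 d hd]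
      rfl
    · intro n hn
      rcases h3 n hn with h | ⟨d, hd, h⟩
      · left; simp [h]
      · rcases List.mem_cons.1 hd with rfl | hd
        · left; simp [h]
        · right; exact ⟨d, hd, h⟩

theorem csols_complete {K : ℕ} (S : Set (Equiv.Perm (Fin K))) (hS : GoodS K S)
    (T : ℕ → ℕ → ℕ) (st : CState)
    (hI : CInv S T st) (i j k l : ℕ) (hi : i < K) (hk : k < K)
    (σ : Equiv.Perm (Fin K)) (hσ : σ ∈ S) (hij : sv σ i = j) (hkl : sv σ k = l)
    (ha : ∀ p < K, ∀ q < K, p ≠ q → (T q (sv σ q)).testBit (K * p + sv σ p) = false)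
    (hb : ∀ n, st.full.testBit n = true → ∃ p < K, (T p (sv σ p)).testBit n = true) :
    (vals σ).reverse ∈ csols st i j k l := by
  have hK : 0 < K := by omega
  have hne : ∀ p < K, sv σ p ≠ p := by
    intro p hp h
    have := hS.ne σ hσ ⟨p, hp⟩
    apply this
    apply Fin.ext
    simpa [sv, hp] using h
  unfold csols
  rw [nforce_eq, nforce_eq, nforce_eq, hI.rows, rnth_tbl _ _ _ hi, rnth_tbl _ _ _ hk,
    rget_rowOf _ _ _ _ _ (hij ▸ sv_lt hK σ i) (hij ▸ hne i hi),
    rget_rowOf _ _ _ _ _ (hkl ▸ sv_lt hK σ k) (hkl ▸ hne k hk), tbl, List.range_eq_range',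
    mkRows_eq, ← List.range_eq_range']
  set F : ℕ := Nat.lor (T i j) (T k l) with hF
  have hFor : F = T i j ||| T k l := rfl
  have hFb : ∀ p < K, p ≠ i → p ≠ k → F &&& 2 ^ (K * p + sv σ p) = 0 := by
    intro p hp h1 h2
    apply and_two_pow_eq_zero
    rw [hFor, Nat.testBit_or, ← hij, ← hkl, ha p hp i hi h1, ha p hp k hk h2]
    rfl
  have key := dfs_complete st.full
    ((List.range K).map (fun q => mkRow' F i j (T i j) k l (T k l) q (rowOf K q (T q) K)))
    ((List.range K).map (fun p => (sv σ p, (if p = i ∨ p = k then 0 else 2 ^ (K * p + sv σ p)),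
      T p (sv σ p)))) ?_ F [] [] ?_
  · simpa [vals, Function.comp_def] using key
  · rw [List.forall₂_map_left_iff, List.forall₂_map_right_iff, List.forall₂_same]
    intro p hp
    rw [List.mem_range] at hp
    simp only [mkRow']
    by_cases h1 : p = i
    · subst h1; rw [if_pos rfl, if_pos (Or.inl rfl), hij]; exact Or.inl ⟨rfl, rfl, rfl⟩
    · by_cases h2 : p = k
      · subst h2; rw [if_neg h1, if_pos rfl, if_pos (Or.inr rfl), hkl]; exact Or.inl ⟨rfl, rfl, rfl⟩
      · rw [if_neg h1, if_neg h2, if_neg (by tauto)]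
        exact rmem_rfilt _ _ _ _ _ (rmem_rowOf _ _ _ _ _ (sv_lt hK σ p) (hne p hp))
          (hFb p hp h1 h2)
  · apply compat_of
    · intro c hc
      rw [List.mem_map] at hc
      obtain ⟨p, hp, rfl⟩ := hc
      rw [List.mem_range] at hp
      dsimp only
      split
      · simp
      · rename_i h; exact hFb p hp (by tauto) (by tauto)
    · rw [List.pairwise_map]
      have := List.pairwise_lt_range (n := K)
      refine List.Pairwise.imp_of_mem ?_ this
      intro p q hp hq hpq
      rw [List.mem_range] at hp hq
      dsimp only
      split
      · simp
      · exact and_two_pow_eq_zero _ _ (ha q hq p hp (by omega))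
    · intro n hn
      obtain ⟨p, hp, h⟩ := hb n hn
      right
      exact ⟨_, List.mem_map.2 ⟨p, List.mem_range.2 hp, rfl⟩, h⟩

theorem cloop_some (ok : List ℕ → Bool) (g : List ℕ → ℕ → Option ℕ) (sols : List (List ℕ))
    (cs : ℕ) (h : cloop ok g sols cs ≠ none) (s : List ℕ) (hs : s.reverse ∈ sols)
    (hok : ok s = true) : ∃ cs', g s cs' ≠ none := by
  induction sols generalizing cs with
  | nil => simp at hs
  | cons x xs ih =>
    change lforce (lrev x []) (fun s' =>
      (Bool.rec (cloop ok g xs cs) (Option.rec none (fun cs' => cloop ok g xs cs') (g s' cs)) (ok s')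
        : Option ℕ)) ≠ none at h
    rw [lforce_eq, lrev_eq, List.append_nil, boolrec_ite] at h
    rcases List.mem_cons.1 hs with hs | hs
    · have hx : x.reverse = s := by rw [← hs, List.reverse_reverse]
      rw [hx, hok, if_pos rfl] at h
      refine ⟨cs, ?_⟩
      intro hg
      rw [hg] at h
      exact h rfl
    · split at h
      · cases hg : g x.reverse cs with
        | none => rw [hg] at h; exact (h rfl).elim
        | some c => rw [hg] at h; exact ih c h hs
      · exact ih cs h hs

theorem mask_bit_ne (K n m : ℕ) (hn : K * K ≤ n) (p w : ℕ) (hp : p < K) (hw : w < K)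
    (hm : m = K * p + w) : (2 ^ n).testBit m = false := by
  rw [Nat.testBit_two_pow, decide_eq_false_iff_not]
  have : K * p + w < K * K := by nlinarith
  omega

theorem cadd_inv {K : ℕ} {α : Type} (S : Set (Equiv.Perm (Fin K))) (hS : GoodS K S)
    (T : ℕ → ℕ → ℕ) (st : CState)
    (hK : 0 < K) (hI : CInv S T st) (τ : Equiv.Perm (Fin K)) (hτ : τ ∈ S) :
    ∃ T' st', CInv S T' st' ∧ ∀ f : CState → α, cadd K st (vals τ) f = f st' := by
  have hs : ∀ σ ∈ S, ∀ p < K, sv σ p < K ∧ sv σ p ≠ p := by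
    intro σ hσ p hp
    refine ⟨sv_lt hK σ p, fun h => hS.ne σ hσ ⟨p, hp⟩ (Fin.ext ?_)⟩
    simpa [sv, hp] using h
  have hτ' := hS.inv τ hτ
  obtain ⟨n, hn, hhit⟩ := hI.hit
  set M1 : ℕ := st.hit ||| pmask K (vals τ) 0 with hM1
  set M2 : ℕ := 2 * st.hit ||| pmask K (vals τ⁻¹) 0 with hM2
  have hpm : ∀ ρ : Equiv.Perm (Fin K), ∀ q < K, ∀ w < K,
      (pmask K (vals ρ) 0).testBit (K * q + w) = true → sv ρ q = w := by
    intro ρ q hq w hw h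
    rw [vals, List.range_eq_range', pmask_testBit _ _ _ _ _ _ (sv_lt hK ρ) hw] at h
    exact h.2.2
  have h2hit : 2 * st.hit = 2 ^ (n + 1) := by rw [hhit, pow_succ]; ring
  have h4hit : 4 * st.hit = 2 ^ (n + 2) := by rw [hhit, pow_succ, pow_succ]; ring
  have h3hit : 3 * st.hit = 2 ^ n ||| 2 ^ (n + 1) := by
    have e : 2 ^ (n + 1) + 2 ^ n = 2 ^ (n + 1) ||| 2 ^ n := by
      have := Nat.two_pow_add_eq_or_of_lt (b := 2 ^ n) (i := n + 1)
        (Nat.pow_lt_pow_right (by norm_num) (by omega)) 1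
      simpa using this
    rw [Nat.or_comm, ← e, hhit, pow_succ]; ring
  have hM1bit : M1.testBit n = true := by rw [hM1, Nat.testBit_or, hhit]; simp
  have hM2bit : M2.testBit (n + 1) = true := by rw [hM2, Nat.testBit_or, h2hit]; simp
  have hM1' : ∀ q < K, ∀ w < K, M1.testBit (K * q + w) = true → sv τ q = w := by
    intro q hq w hw h
    rw [hM1, Nat.testBit_or, hhit, mask_bit_ne K n _ hn q w hq hw rfl, Bool.false_or] at h
    exact hpm τ q hq w hw h
  have hM2' : ∀ q < K, ∀ w < K, M2.testBit (K * q + w) = true → sv τ⁻¹ q = w := by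
    intro q hq w hw h
    rw [hM2, Nat.testBit_or, h2hit, mask_bit_ne K (n + 1) _ (by omega) q w hq hw rfl,
      Bool.false_or] at h
    exact hpm τ⁻¹ q hq w hw h
  set T1 : ℕ → ℕ → ℕ := fun p w => if w = sv τ p then T p w ||| M1 else T p w with hT1
  set T2 : ℕ → ℕ → ℕ := fun p w => if w = sv τ⁻¹ p then T1 p w ||| M2 else T1 p w with hT2
  have hmono : ∀ p w m, (T p w).testBit m = true → (T2 p w).testBit m = true := by
    intro p w m h
    simp only [hT2, hT1]
    split_ifs <;> simp [h]
  have hτbit : ∀ p, (T2 p (sv τ p)).testBit n = true := by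
    intro p
    simp only [hT2, hT1]
    split_ifs <;> simp [hM1bit]
  have hτibit : ∀ p, (T2 p (sv τ⁻¹ p)).testBit (n + 1) = true := by
    intro p
    simp only [hT2, if_true, Nat.testBit_or, hM2bit, Bool.or_true]
  have hT2cases : ∀ p w m, (T2 p w).testBit m = true → (T p w).testBit m = true ∨
      (w = sv τ p ∧ M1.testBit m = true) ∨ (w = sv τ⁻¹ p ∧ M2.testBit m = true) := by
    intro p w m h
    simp only [hT2, hT1] at h
    split_ifs at h <;> (try simp only [Nat.testBit_or, Bool.or_eq_true] at h) <;> tauto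
  refine ⟨T2, ⟨tbl K T2, st.full ||| 3 * st.hit, 4 * st.hit⟩, ?_, ?_⟩
  · refine ⟨rfl, ⟨n + 2, by omega, h4hit⟩, ?_⟩
    intro σ hσ
    by_cases e1 : σ = τ
    · subst e1
      exact Or.inl ⟨n, hn, fun p _ => hτbit p⟩
    by_cases e2 : σ = τ⁻¹
    · subst e2
      exact Or.inl ⟨n + 1, by omega, fun p _ => hτibit p⟩
    rcases hI.perm σ hσ with ⟨m, hm, h⟩ | ⟨ha, hb⟩
    · exact Or.inl ⟨m, hm, fun p hp => hmono _ _ _ (h p hp)⟩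
    · right
      refine ⟨?_, ?_⟩
      · intro p hp q hq hpq
        by_contra hcon
        rw [Bool.not_eq_false] at hcon
        have hgen : ∀ ρ ∈ S, σ ≠ ρ → sv σ q = sv ρ q → sv ρ p = sv σ p → False := by
          intro ρ hρ hne h1 h2
          have := hS.uniq σ hσ ρ hρ ⟨p, hp⟩ ⟨q, hq⟩ hne
            (by apply Fin.ext; simpa [sv, hp] using h2.symm)
            (by apply Fin.ext; simpa [sv, hq] using h1)
          exact hpq (by simpa using this)
        rcases hT2cases _ _ _ hcon with h | ⟨h1, h2⟩ | ⟨h1, h2⟩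
        · rw [ha p hp q hq hpq] at h; simp at h
        · exact hgen τ hτ e1 h1 (hM1' p hp _ (sv_lt hK σ p) h2)
        · exact hgen τ⁻¹ hτ' e2 h1 (hM2' p hp _ (sv_lt hK σ p) h2)
      · intro m hm
        simp only [h3hit, Nat.testBit_or, Bool.or_eq_true, Nat.testBit_two_pow,
          decide_eq_true_eq] at hm
        rcases hm with hm | rfl | rfl
        · obtain ⟨p, hp, h⟩ := hb m hm
          exact ⟨p, hp, hmono _ _ _ h⟩
        · obtain ⟨p, hp⟩ := hS.agree σ hσ τ hτ e1 e2
          refine ⟨p, p.2, ?_⟩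
          rw [show sv σ p = sv τ p by rw [sv_val, sv_val, hp]]
          exact hτbit p
        · obtain ⟨p, hp⟩ := hS.agree σ hσ τ⁻¹ hτ' e2 (by rwa [inv_inv])
          refine ⟨p, p.2, ?_⟩
          rw [show sv σ p = sv τ⁻¹ p by rw [sv_val, sv_val, hp]]
          exact hτibit p
  · intro f
    unfold cadd
    rw [lforce_eq, nforce_eq, nforce_eq, radd_eq, radd_eq, nforce_eq, nforce_eq, linv_vals]
    have z1 := zipWith_tbl K T M1 (sv τ) (hs τ hτ)
    have z2 := zipWith_tbl K T1 M2 (sv τ⁻¹) (hs τ⁻¹ hτ')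
    rw [hI.rows]
    change f ⟨List.zipWith (fun row v => rmod' v M2 row)
      (List.zipWith (fun row v => rmod' v M1 row) (tbl K T) ((List.range K).map (sv τ)))
      ((List.range K).map (sv τ⁻¹)), _, _⟩ = _
    rw [z1, z2]
    rfl

theorem nbeq_false (a b : ℕ) : Nat.beq a b = false ↔ a ≠ b := by
  rw [← Bool.not_eq_true, Nat.beq_eq]

theorem cvalid_spec {K : ℕ} (S : Set (Equiv.Perm (Fin K))) (hS : GoodS K S)
    (T : ℕ → ℕ → ℕ) (st : CState) (hI : CInv S T st) (i j k l : ℕ)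
    (hi : i < K) (hj : j < K) (hk : k < K) (hl : l < K) (hv : cvalid K st i j k l = true) :
    ∃ σ ∈ S, (vals σ).reverse ∈ csols st i j k l := by
  unfold cvalid at hv
  simp only [Bool.and_eq_true, Bool.not_eq_true', nbeq_false, Nat.beq_eq,
    Bool.and_eq_false_iff] at hv
  obtain ⟨⟨⟨⟨⟨h1, h2⟩, h3⟩, h4⟩, h5⟩, h6⟩ := hv
  obtain ⟨σ, hσ, e1, e2⟩ := hS.ex ⟨i, hi⟩ ⟨j, hj⟩ ⟨k, hk⟩ ⟨l, hl⟩ (by simpa using h3)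
    (by simpa using h4) (by simpa using h1) (by simpa using h2) (by
      simp only [Fin.mk.injEq]; tauto)
  have hij : sv σ i = j := by simp [sv, hi, e1]
  have hkl : sv σ k = l := by simp [sv, hk, e2]
  refine ⟨σ, hσ, ?_⟩
  rcases hI.perm σ hσ with ⟨m, hm, h⟩ | ⟨ha, hb⟩
  · exfalso
    rw [hI.rows, rnth_tbl _ _ _ hi, rnth_tbl _ _ _ hk, rget_rowOf _ _ _ _ _ hj (Ne.symm h1),
      rget_rowOf _ _ _ _ _ hl (Ne.symm h2)] at h6
    have h7 : ((T i j &&& T k l) >>> (K * K)).testBit (m - K * K) = true := by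
      rw [Nat.testBit_shiftRight, Nat.add_sub_cancel' hm, Nat.testBit_and]
      have a1 := h i hi
      have a2 := h k hk
      rw [hij] at a1
      rw [hkl] at a2
      rw [a1, a2]; rfl
    change (T i j &&& T k l) >>> (K * K) = 0 at h6
    rw [h6] at h7
    simp at h7
  · exact csols_complete S hS T st hI i j k l hi hk σ hσ hij hkl ha hb

theorem check_sound {K : ℕ} (hK : 0 < K) (S : Set (Equiv.Perm (Fin K))) (hS : GoodS K S)
    (ok : List ℕ → Bool) (hok : ∀ σ ∈ S, ok (vals σ) = true) (fuel : ℕ) (T : ℕ → ℕ → ℕ)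
    (st : CState) (hI : CInv S T st) (cs : ℕ) : check K ok fuel st cs = none := by
  induction fuel generalizing T st cs with
  | zero => rfl
  | succ fuel ih =>
    change (nforce (Nat.mod cs K) fun l =>
        nforce (Nat.mod (Nat.div cs K) K) fun k =>
        nforce (Nat.mod (Nat.div cs (Nat.mul K K)) K) fun j =>
        nforce (Nat.mod (Nat.div cs (Nat.mul K (Nat.mul K K))) K) fun i =>
        nforce (Nat.div cs (Nat.mul (Nat.mul K K) (Nat.mul K K))) fun cs' =>
        (Bool.rec none
          (cloop ok (fun s cs'' => cadd K st s (fun st' => check K ok fuel st' cs''))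
            (csols st i j k l) cs')
          (cvalid K st i j k l) : Option ℕ)) = none
    simp only [nforce_eq]
    rw [boolrec_ite]
    split
    · rename_i hv
      obtain ⟨σ, hσ, hmem⟩ := cvalid_spec S hS T st hI _ _ _ _ (Nat.mod_lt _ hK) (Nat.mod_lt _ hK)
        (Nat.mod_lt _ hK) (Nat.mod_lt _ hK) hv
      by_contra hcon
      obtain ⟨cs', h⟩ := cloop_some _ _ _ _ hcon (vals σ) hmem (hok σ hσ)
      obtain ⟨T', st', hI', heq⟩ := cadd_inv (α := Option ℕ) S hS T st hK hI σ hσ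
      rw [heq] at h
      exact h (ih T' st' hI' cs')
    · rfl

theorem rootState_inv {K : ℕ} (hK : 0 < K) (S : Set (Equiv.Perm (Fin K))) (hS : GoodS K S)
    (τ : Equiv.Perm (Fin K)) (hτ : τ ∈ S) :
    ∃ T st, CInv S T st ∧ ∀ (f : CState → Bool), rootState K (vals τ) f = f st := by
  have h0 : CInv S (ustart K) ⟨tbl K (ustart K), 0, 2 ^ (K * K)⟩ := by
    refine ⟨rfl, ⟨K * K, le_rfl, rfl⟩, ?_⟩
    intro σ hσ
    right
    refine ⟨?_, by simp⟩
    intro p hp q hq hpq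
    apply ustart_testBit _ _ _ _ _ hq (sv_lt hK _ _) (sv_lt hK _ _) hp
    · intro h; exact hpq (sv_inj σ p q hp hq h)
    · rintro ⟨h1, h2⟩
      apply hS.ne2 σ hσ ⟨p, hp⟩
      apply Fin.ext
      rw [← sv_val, ← sv_val]
      simp only
      rw [h2, ← h1]
  obtain ⟨T, st, hI, h⟩ := cadd_inv (α := Bool) S hS _ _ hK h0 τ hτ
  refine ⟨T, st, hI, fun f => ?_⟩
  rw [← h f]
  unfold rootState
  rw [tstart_eq, List.append_nil]
  rfl

/-- Reading off a successful run on a range of root solutions. -/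
theorem crun_spec {K : ℕ} (hK : 0 < K) (S : Set (Equiv.Perm (Fin K))) (hS : GoodS K S)
    (ok : List ℕ → Bool) (hok : ∀ σ ∈ S, ok (vals σ) = true)
    (τ : Equiv.Perm (Fin K)) (hτ : τ ∈ S) (i j k l : ℕ)
    (hi : i < K) (hj : j < K) (hk : k < K) (hl : l < K) (L : List (ℕ × ℕ × ℕ))
    (hL : ∀ c ∈ L, crun K ok (vals τ) i j k l c.1 c.2.1 c.2.2 = true)
    (hcov : ∀ x : ℕ, ∃ c ∈ L, c.1 ≤ x ∧ (c.2.1 = 0 ∨ x < c.1 + c.2.1)) : False := by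
  obtain ⟨T, st, hI, hst⟩ := rootState_inv hK S hS τ hτ
  have hrun : ∀ c ∈ L, cvalid K st i j k l = true ∧
      cloop ok (fun s' cs => cadd K st s' (fun st' => check K ok 9 st' cs))
        (if c.2.1 = 0 then (csols st i j k l).drop c.1
          else ((csols st i j k l).drop c.1).take c.2.1) c.2.2 ≠ none := by
    intro c hc
    have h := hL c hc
    unfold crun at h
    rw [hst, boolrec_ite, boolrec_ite, ltake_eq, ldrop_eq] at h
    simp only [Nat.beq_eq] at h
    split at h
    · rename_i hv
      refine ⟨hv, fun hn => ?_⟩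
      rw [hn] at h
      simp at h
    · simp at h
  obtain ⟨c0, hc0, -⟩ := hcov 0
  obtain ⟨σ, hσ, hmem⟩ := cvalid_spec S hS T st hI _ _ _ _ hi hj hk hl (hrun c0 hc0).1
  obtain ⟨x, hx, hxe⟩ := List.getElem_of_mem hmem
  obtain ⟨c, hc, h1, h2⟩ := hcov x
  have hmem' : (vals σ).reverse ∈ (if c.2.1 = 0 then (csols st i j k l).drop c.1
      else ((csols st i j k l).drop c.1).take c.2.1) := by
    split
    · rw [List.mem_drop_iff_getElem]
      refine ⟨x - c.1, by omega, ?_⟩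
      rw [← hxe]
      congr 1
      omega
    · rw [List.mem_take_iff_getElem]
      refine ⟨x - c.1, by simp; omega, ?_⟩
      simp only [List.getElem_drop]
      rw [← hxe]
      congr 1
      omega
  obtain ⟨cs', h⟩ := cloop_some _ _ _ _ (hrun c hc).2 (vals σ) hmem' (hok σ hσ)
  obtain ⟨T', st', hI', heq⟩ := cadd_inv (α := Option ℕ) S hS T st hK hI σ hσ
  rw [heq] at h
  exact h (check_sound hK S hS ok hok _ T' st' hI' cs')

noncomputable def lget (s : List Nat) : Nat → Nat :=
  List.rec (fun _ => 0) (fun x _ ih n => Nat.rec x (fun m _ => ih m) n) s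

noncomputable def lpow (s : List Nat) (x n : Nat) : Nat :=
  Nat.rec x (fun _ ih => lget s ih) n

/-- all permutations are allowed -/
def okAll (_ : List Nat) : Bool := true

/-- the permutation is not a 9-cycle -/
noncomputable def okNotNine (s : List Nat) : Bool :=
  Bool.rec (not (Nat.beq (lpow s 0 9) 0)) true (Nat.beq (lpow s 0 3) 0)

/-- the `m`-th power of the permutation is trivial -/
noncomputable def okPow (m : Nat) (s : List Nat) : Bool :=
  List.rec true (fun x _ ih => Bool.rec false ih (Nat.beq (lpow s x m) x)) s

set_option exponentiation.threshold 100000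

/-- certificate -/
def certSix_0 : ℕ :=
  0

theorem runSix_0 : crun 6 okAll [1, 2, 3, 4, 5, 0] 0 4 1 5 0 0
    certSix_0 = true := by
  decide +kernel

theorem noSix (S : Set (Equiv.Perm (Fin 6))) (hS : GoodS 6 S)
    (hok : ∀ σ ∈ S, okAll (vals σ) = true) (τ : Equiv.Perm (Fin 6)) (hτ : τ ∈ S)
    (hv : vals τ = [1, 2, 3, 4, 5, 0]) : False := by
  refine crun_spec (by norm_num) S hS _ hok τ hτ 0 4 1 5 (by norm_num) (by norm_num)
    (by norm_num) (by norm_num)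
    [(0, 0, certSix_0)] ?_ ?_
  · rw [hv]
    simp only [List.forall_mem_cons]
    refine ⟨runSix_0, ?_⟩
    simp
  · intro x
    simp

/-- certificate -/
def certThreeThree_0 : ℕ :=
  0

theorem runThreeThree_0 : crun 6 (okPow 3) [1, 2, 0, 4, 5, 3] 0 3 1 4 0 0
    certThreeThree_0 = true := by
  decide +kernel

theorem noThreeThree (S : Set (Equiv.Perm (Fin 6))) (hS : GoodS 6 S)
    (hok : ∀ σ ∈ S, (okPow 3) (vals σ) = true) (τ : Equiv.Perm (Fin 6)) (hτ : τ ∈ S)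
    (hv : vals τ = [1, 2, 0, 4, 5, 3]) : False := by
  refine crun_spec (by norm_num) S hS _ hok τ hτ 0 3 1 4 (by norm_num) (by norm_num)
    (by norm_num) (by norm_num)
    [(0, 0, certThreeThree_0)] ?_ ?_
  · rw [hv]
    simp only [List.forall_mem_cons]
    refine ⟨runThreeThree_0, ?_⟩
    simp
  · intro x
    simp

/-- certificate -/
def certNine_0 : ℕ :=
  14242208974355294929519712635053642874561869203065239830335857879333553973995755738104253978534936219873996984865858439142801320057521788262333900258037532682674942035771642248058300429007089827317241895699790385265366100075233518235400691162376902307769994203179199348637013424249682630229752541013933829058881994331132085474451005118074981911635236597800384528611240489188639169603939535698836706855597113549883476280607647370438840653148483583940122878008887707881755970146873230291635747037941488809666059968619805118835143051030389012125719810760907488764695001166422913101278688585388131585054119397869391881376178057877363722523545548278363447394519860020800792612686294817637689163254550261730311095241398813608242402294954444062108041632104157472834218106984630728587134728813937183974438873754955503566729570725950572379413007843002251158420542353597128864377055575503896493853716592318435825739588999195068451043159608198624120438387891496539759960432000447616839226560623758003978999533085336155653495770480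

theorem runNine_0 : crun 9 okAll [1, 2, 3, 4, 5, 6, 7, 8, 0] 0 8 6 7 0 9
    certNine_0 = true := by
  decide +kernel

/-- certificate -/
def certNine_1 : ℕ :=
  179885168021409784988252664357763853318908601228897588712592864773369084988983558282284157115017883949060225859782651151558155757810586072038589193128181997253059666148842950088427027785575865028521959855969480722465915689337862216137651369076854640806364714077758144720450525146703347202247218963236538313840372558686472203005581140819905370518950714076604423718685194376524352049785211157901282031983763473981467669941816130503841903518484385057442691485494478627977473196228453009538814396013899339893070673337859910737134341404828201950027250812980724451088064861341632015328392623212493283275504799831490054324157861471894406804981838175045195741531738297733451389092957652013360011557238996345659293151426717238650759180306789113782859234195197919361539064886025551971945707255391364730451374769279121431405180656484378606893567530105836902404862506711931553059709834224046541824116535411853466709921644277141099178800091735387109741686774686042539043085990405619756959130685181411602100267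

theorem runNine_1 : crun 9 okAll [1, 2, 3, 4, 5, 6, 7, 8, 0] 0 8 6 7 9 9
    certNine_1 = true := by
  decide +kernel

/-- certificate -/
def certNine_2 : ℕ :=
  175155583097146249052971195910569310564327286268395314466543742091877575922846929288085455024564365263297071501972722629370686471618212194947182048092254607691486158266259925418050007068603326854712482973017873441804547883983205713666673297685303941039598912614549434031657799464503166061634175158704636011069121244313403443600220825765654010173867341145594866851265446688965474257497253586237593059860510825638617312620888223111030750666370093336154941309466927860716992166831462815573121623034925818614429397739343089565533368108762632001409545504010092237015647960386674384999654877437454764919653782204645027837332758769645162373609586367865362641157454664736833115593946581688560473391296144526236228824598196910883053312772151549323234507334608120594698407683208588938834762955727223511667134234606004134975279145320869939584012614297941442257297544216514889674164164053452685225085266534893953006408848811189525521660573875531407039200220603592625620599892790338087936047562559338543557257123090867942117189496805909591695063265302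

theorem runNine_2 : crun 9 okAll [1, 2, 3, 4, 5, 6, 7, 8, 0] 0 8 6 7 18 9
    certNine_2 = true := by
  decide +kernel

/-- certificate -/
def certNine_3 : ℕ :=
  1523973275086539971977707207221414927169483416625741990829398887840619457745418933527059219724439513362474106696774734359093437486641151296421967563772842439037815200385293056556005782956345550117796684780329008625772052206142219473214459844315158165830674587779682460527991142444117405443390619045599278866885935221530800999891731170396826366376945094358571629236347689257880686489218605044347766755098388878921312452523952305901496288245208788942443823573573581187939904907851034517329657471691097363543059731948651024810584558500598106017465001917810543751220568671845015241599722850774396272337235569580942329448678853706962927820577120856630780793621133815809973118985832842682222439923774113552063571730659225642891274503431029103701045761192694545449723337872724222455277579753090740396286999329819227979072886318521578834946921547359457093227126496186690641829033245535381815433395425284172695578296878868628053308655142820211498841520140542036750147818318743737113489068726620415641463209255139936788421243923216820858788199554711087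

theorem runNine_3 : crun 9 okAll [1, 2, 3, 4, 5, 6, 7, 8, 0] 0 8 6 7 27 9
    certNine_3 = true := by
  decide +kernel

/-- certificate -/
def certNine_4 : ℕ :=
  2996536977435999623857082076097003667161639570864609183505191797517907590169297103237655535997957274936481592181845433850522047002464645044826725347033571796429406873928100976708996326800867332464450270609918705030510671466991147902131956389235069451255289646295849877707839457577256286254188376994882257038104390393830425394501632327616155108326758268421396250252888805766482700647915118525693001122845643458591803933511844521621611342172863726222718112235382877873228892137267308462370304539578241595336233078353058891376463040867994272679943593564819457031696954137787407642847265193521390669360699884247045324596618706722272520562179058891127045427626655891818451489375905209385078199180628125845033374144815595315862622974600454925291599104927872667432914728733639339210556431761417800823137942163336589272058186070784278503951248805737590764773681882027211420715304277842503269943223293265634985900056260383017486743058745016380930618031132121017171029680120650442517536274348749185600982606942570148146704561249535863473293860760933772926491638059599089604882635975077721749801139170583690585433965667900812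

theorem runNine_4 : crun 9 okAll [1, 2, 3, 4, 5, 6, 7, 8, 0] 0 8 6 7 36 10
    certNine_4 = true := by
  decide +kernel

/-- certificate -/
def certNine_5 : ℕ :=
  3353162618839638545190991246976929751319714522128347237206026067662256483371122561483529583458003195112072683793856870108165740689847900457504407415865282903369457705465805864392999180855896244536905423295710661901445580408584041644917439868759017859910968326596287305486325557425102100802629493119852649483653327683572783755840074578299276925420090136618684906453337476061893073464223138371186020961302452236785738548245714124010342599112018896815339933733803444159879015706201446904131308671214532635696226249038935336615199546036784257354251113244226892301849135949266575840003509718356072736394373465437538166715606349252422496818504655989780105665950005604894472731116369890303973062482399305894824252370039657712488351340588145391799775145009664416849044357805545080549562530677668182036406380037209278996033894556042189903791360159828489680565349180115107879608350899162345959337897435533327551641988337870937895673182679898661008782882566532911493660615045741003326986817199681447848158860433630457466952059686092127173307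

theorem runNine_5 : crun 9 okAll [1, 2, 3, 4, 5, 6, 7, 8, 0] 0 8 6 7 46 9
    certNine_5 = true := by
  decide +kernel

/-- certificate -/
def certNine_6 : ℕ :=
  47973696404654717064254958755770416314052667463431745126390987241253899335013730623986186252928578920108790427769805417386519530753088855884346695594600342062429468079321543467371925784861263016781251646885528158458293613383618795075527728872844188867755503714962418523951955287113173736212570298904049503326686030213462513152703194593779570453261358493583578380357407964584537863597274609171560451182220545801460557239807973038331608288178758253617782487588713879181836391739785808184927115773477337367000172165560183473059535272359317115585582310337591412251851260930253960604378700245285416217967942161025135068327878634102856013292477756617497772517143026918181393497267386891792608105619766803482954497003651336038945546417495941345426222459005333043162048925277660305721654315699945442720755424582457692332672502686667789608262541529318245577650313104456149578854860887867491997908813404174864373711687723795099871704706354728402483570919661093390332812544682159931608929679817637539656120393266286331229310645380462028975481329977130546372423693728708268080635802062563290086212037551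

theorem runNine_6 : crun 9 okAll [1, 2, 3, 4, 5, 6, 7, 8, 0] 0 8 6 7 55 10
    certNine_6 = true := by
  decide +kernel

/-- certificate -/
def certNine_7 : ℕ :=
  87072840049139057354550377211489606461322138956499291930008635017460838652045108137905762664190685363629405757505592719894699298520696206398294484311193779081183479276839226189415369660140270835612595788463807196853892825079977284466933515875949061113694211984806572366257159156847844703532842410834810984628775670514112234899629356980138070498019803348092243622034137512383419238167301150938732991201859877737479817114009781383857329952305382942784397168445509307535477171399435059119221599242322250426584878023065630324851418194464537699184903194284280599433808386113536501029101228754795079432582386477435993875310783651544914560818331164118921760865597053570098432444771968140705298194451301564900987955551315493650982936153759983538915440669206704684078619782827741948432147759534806314531351702807853061786043217874756227482141991357012603456101720485437172198162210955737846944956882182742216904822328772527002199524136625768210650026885150754660711799310629810921528766467538045548410234053088416657803769912019671575914533640044479091583265931759311114885205765189327608024283783587406831332598622164379819816743987909606591715715131857951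

theorem runNine_7 : crun 9 okAll [1, 2, 3, 4, 5, 6, 7, 8, 0] 0 8 6 7 65 10
    certNine_7 = true := by
  decide +kernel

/-- certificate -/
def certNine_8 : ℕ :=
  12432656300643905380438934028078163275738272296993605092172645010298268303198033441130537611526405015265925077185490395823168247918418173746118875654351727011697061765756685264444649303101619517730513904817372928864113411620600555632492019421377861395936440376568857865679014252221835929906742900460279008774918477180793343266894936742353995856590730378561658930068037819215805686047645195983263945188637516149211212486372818459371147951665962865616291136998853114681664792743750157523234811359362267277255671829532726831192346344905367156943974603733916615132378485217511211870585769355705939003111349458721645974528656276739492465098710863767434291833466963386387809843113444159756645748515934477835264560886380507839696728019689590232756084180956632897617436558312014107335383102527691985728632198855475911477341904828751999840125654769481726187009594043699523400278360789624741067076273838688856570692936024143462872450614286627336186310847324679350740146569269839686634185810378550959953382621937359230725690397135260863836312592998229596885892823718613195184514035040311129842069374209340083930132585849542317067373455756844097254200758189232703193667904017483622233863653324366230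

theorem runNine_8 : crun 9 okAll [1, 2, 3, 4, 5, 6, 7, 8, 0] 0 8 6 7 75 10
    certNine_8 = true := by
  decide +kernel

/-- certificate -/
def certNine_9 : ℕ :=
  1463633278857913579031637552244515738138611894120345736077008322363215303664552374441930329809118373714902742887023240583884274590467604603859465411008725201322083825997390184868889633728989828618155036497051073408702139595620931810706689511221493639201269413417047100891707179063276267148542777916477089906808572232806982351031528054158727047483245464422417287715743608835064589443203904308057598800927655379101451050131378252483501689607411910883407851903764931909649585267505411826161821547425942683298711856440249996549000433597355149585521903706790147448912571080183988868912816599792059212593652644625166946707866188740930238386300037960105256980185806778071075225795268247150416507716792049695883136039565286746968340464487381466950436205697277349588500752717046283087623164221210048084230091727078522627994822077109805301800300980853568532701515471734465418744163448012957206346234543219987565130502016309664877023834213609128690913106061647439831454648922359032204861816867436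

theorem runNine_9 : crun 9 okAll [1, 2, 3, 4, 5, 6, 7, 8, 0] 0 8 6 7 85 9
    certNine_9 = true := by
  decide +kernel

/-- certificate -/
def certNine_10 : ℕ :=
  142712371248119222694134805063639120022753108009648748229039373740470400479799917686253293750649237902796475873198525139432778300610950606126224939318421568038584361120734807685604749202277434382949651850220243020274498833457446852171452206300733161160369786371576186230856276697660408377396995951915488518406496120563110559036521466055330507177857451083032071923242708285326708863491923840989530733262033206367388114394402620848434531682830219551105612975364787093052459417693040402555104213540820950784052682599465495168877365729176611895356494323222259284596386972707346974302487247552881954581670793864474335841030208772478855054309301191607296167335579630665017431950959766682281636846294903940098366725569038861422927061302036851218066153164017216408393229039890972461397351714984051370648762875172909358975828194457950135176329188283057637435080428411227854930187020838153436028322188244419500454390233230645502269592706145086876501548258766133523933327719563769749886277066489784892771743248525024298558507934332499761203081216408536143655762677456955383210169972986614307226121184751272748321136605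

theorem runNine_10 : crun 9 okAll [1, 2, 3, 4, 5, 6, 7, 8, 0] 0 8 6 7 94 10
    certNine_10 = true := by
  decide +kernel

/-- certificate -/
def certNine_11 : ℕ :=
  1255636066207136394917578674739192229666244864242437615837432292455464188928666319147652336504128080584527795158790163817257881160562680123551734249948463517254573717050215720357648268407913178576976659118310648079587198913577713985209142816864481034914289666837782844810144724417384322995864726752680751008492079396715889700522656070536408596990994440851875350146136084073804362600892386256693804108659368213902365864521061750646262701399276036390935322408520332304932933133381485614634360286348830569142494574361450629950302428364723905893890863951770730293920787846289246291820338768562999857268175044005911689869369813572083101263565014788513778214434069030673129133325162915409055291919315077241949269125293031607200836239466903724924656653776449552898969144515023426152024170347653589272213011996891509692690448260369255776836367142936533125825687083983796558101315004671929941001638996781574817497594635595841855646122460578194704859962157317402694469404685276731813691417048473035616228737532505004638994173254133129935398669540984798163099800744447668684497995159359042516154450217490174790902378592183667834067563071296331921586331306110014618162982250089987111062330455602403822274426261634730009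

theorem runNine_11 : crun 9 okAll [1, 2, 3, 4, 5, 6, 7, 8, 0] 0 8 6 7 104 11
    certNine_11 = true := by
  decide +kernel

/-- certificate -/
def certNine_12 : ℕ :=
  104015571527818839562157351832602871782393327120199966471327794390487438412250287100380043323417022007051309036960662453554871722447465159116146229487236598505926430041418653088742123594094615102811875931059202444930119862421251239339838477574456310439138490044724697377956983219228839589458887411047932384585092991701735431655413219322867645947721227542348213469200639062913869382788751050138995367464289930614250349571507691766645986979856099511066103308046006214380229976929525028967918856647404847937561902701001342991213496744874215552505188086521508967679854632386383176512697890781070907531865923086204300173810323429129813387596708526414930599605927485025103396063843154509765127124845693316341088927413533372533014821686392373451868240028433117881264628935756738825107981919767205008334568505622683714016954090924521534009827957294274912992902909503691163335608697995481484999569806381521788937706728974079155819071069192696663021907549050353550525643843836275920295257960768838224853470402523700525253751116859844026032055180953989006402440696782280957958529814688972129124331971488998763269467043685894586732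

theorem runNine_12 : crun 9 okAll [1, 2, 3, 4, 5, 6, 7, 8, 0] 0 8 6 7 115 11
    certNine_12 = true := by
  decide +kernel

/-- certificate -/
def certNine_13 : ℕ :=
  25142888464534202765731243614816877227810021824195456934480512639946488302829485500560617437384411801304715646886054584434811114768702849047099701437960322773381505626651527859887387418609401195104509269564183943064577229920906926439455325298882129020965973725647326614514721566277130248737929221958009425463178200243317502073880439403890419723255874881704013331813482529750183627063998363766896941818892591869268249399385187766443816191258305002830097104445320956105364302318016863818967512784140997514452049254248744936348672193203827056439817058305386694496311780524339156487007431640122528250507325336346444592124547294750964603494489948821414285523259470129694315130520128675666838309054317425871279176494893466477985534337883377048329206324426614258979246272081131993897005821202317169410366676181868597222885658717794006184772982751841807216935622467229402050076044705241399756653205279744060473880371663206502485509067665284325610843942841707296648505741930779322922461204649416247789106110241014842507025657482118638909166308642871739677167246805852366160124947227815439671858518105893282072290602872457977094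

theorem runNine_13 : crun 9 okAll [1, 2, 3, 4, 5, 6, 7, 8, 0] 0 8 6 7 126 10
    certNine_13 = true := by
  decide +kernel

/-- certificate -/
def certNine_14 : ℕ :=
  141030017840838472324181688781991281387771974082414337999910517051434162877938525350205054995547719636914966727079933759984544281481481880648763237234976358189034736533000097938285950022153615500857969654251372863039795791272521227561582381858759016553273845979313640062400045073904971271962655211563080686373913056016519754777180350020771097707068936243175900646628912129841121276992199809084823328527749355914147677846064861885598334564350354216183521351056389449750462646604377160356392603766613038117892827596172510635113286113063581721143452196271896124055064724515109890328211596996449013505760404416456411596361277837172828336381192657132564180614683161400364161666618563007930317302688491357556444091585754734563138354972509349252558727643038009649580895492143010635694057339781722825007771469135520351998223830918552158577384657113641654998305836846318045924623941702846760053312402820402532039627925682007181130729749644666191924730141962044156598809574420381324453206846122248880834107964447373235504968123726906131130996546220278655444736969001618124750066905237878952538997126351204904346130940741302814777799428989829665782784441321692972499372265180098036131605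

theorem runNine_14 : crun 9 okAll [1, 2, 3, 4, 5, 6, 7, 8, 0] 0 8 6 7 136 10
    certNine_14 = true := by
  decide +kernel

/-- certificate -/
def certNine_15 : ℕ :=
  1152634737764211060913618387063147741995929907204287913403370551930469529439880838216975131796559393046679743772002173551350264920366382760275576533789620427987280471157066289257299813543291183190449503939293600049722890692935340780127275358424188386954125042840256653495942777298613486786271580218825209501187202530622579660036910316929615003597171001062482123637514802848672901069781695001430594713134049413852652308211841460997262078326185391233943673689747520307965139546216628979295938149147744511790718191301078596722733620264206094552807371163654868620054867787057491102034170660871652813797709842741284019643119404193817915149222863859526014840498633363459584103067167458297381319858873211055786099746703755192320620655743496447920463319973677856396122327980007968606370592959319804858740975214139287221810418966889982392457848203232946288422293674907722624624863957891539341835578759379176264524407131517780754237435897809799678693690985118769152810168025201476005879828502006108042746615368570570361235630417797902476307114548405835677664177930209873535941488774488587713277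

theorem runNine_15 : crun 9 okAll [1, 2, 3, 4, 5, 6, 7, 8, 0] 0 8 6 7 146 10
    certNine_15 = true := by
  decide +kernel

/-- certificate -/
def certNine_16 : ℕ :=
  1156535042299505604096053750171675025101858358664949399057127597605371148206850650071078084570770128127588307680572648529527245182120669572161724852564331721475901165675538798290758477915756204494730538159266400679817070887059265803494162810867673687566688656724698052982931442190891095304148073971391946437772771101590972197399125373245228569591261652964608551679542509319546650500103860914679639885478194898647452436485078638877911936079495800639109751110354434963271160188032585416815997782082555047658642636502545798134889244149154431994856437328331690345129584534948934863666833217498541523647967296850448351408908411723634033035944346001077986084733812416535940949773853878793569913559524394778802864385948763402986576406491888256229679612759379749961161924603664384150902909605744685208300595866161404416520838155750635269238742840663868687673963612420056831144934548056582848482268824926553237955393834491975743211403274385152432461633052671301085580177337470602140028626050203700877431584023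

theorem runNine_16 : crun 9 okAll [1, 2, 3, 4, 5, 6, 7, 8, 0] 0 8 6 7 156 10
    certNine_16 = true := by
  decide +kernel

/-- certificate -/
def certNine_17 : ℕ :=
  4273024813981907727616451981001634692362182332347641699875752335860633648620836794790545140388365742476323194457036992686309759988218351978484579437724647483435488727496449407954858533262284245908094988511217990576850061824842960991660207573599759452414159784944251549401039851045792241925537217112729531633901657564631657267512015370329408469967148727851254469688190957161803249717009877790706628070426099654314684652815353894845579747867972781223014809002263747665463016730515342008016436430691966723145337056996564055532344797426933908640638879091890973814558693122959524864863739836306454851530594836506925281765164647925002650051899067555305554664578116943646064316974022457325998341863633171442977506957692225707076798806342714736389845355354722742644010656029331363770564602027818626955450598840648981085269440698114102534063333096421721722232143581770087581857441057197196761516343099518715535250222556447248524930671479487996947717437532268633281848712657767277719797216889549816085369806553815935462914673004343383281282274265951968414342018098243788538214469978409009399880355679409365198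

theorem runNine_17 : crun 9 okAll [1, 2, 3, 4, 5, 6, 7, 8, 0] 0 8 6 7 166 10
    certNine_17 = true := by
  decide +kernel

/-- certificate -/
def certNine_18 : ℕ :=
  1767564496062404902844282187732680864999142097829631414569438913506797051994885973349999569481827533517087199492054650201194254089237639157622690087805879427942066481229266940372072982451951932980416434954775546679447222722812251581908029571057486366448755192654238204869500721497590733913928700301855869931003699012521231274674394741470119636776740529565908260925164656076996826963011365870740346253293990695137871752088088924215444854579850750532780748865840734777370660193064849060124580279176429409126625344087746683844112093552362661825122984209478796205054013387714782747899717556210994870554084033772651617989180050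

theorem runNine_18 : crun 9 okAll [1, 2, 3, 4, 5, 6, 7, 8, 0] 0 8 6 7 176 0
    certNine_18 = true := by
  decide +kernel

theorem noNine (S : Set (Equiv.Perm (Fin 9))) (hS : GoodS 9 S)
    (hok : ∀ σ ∈ S, okAll (vals σ) = true) (τ : Equiv.Perm (Fin 9)) (hτ : τ ∈ S)
    (hv : vals τ = [1, 2, 3, 4, 5, 6, 7, 8, 0]) : False := by
  refine crun_spec (by norm_num) S hS _ hok τ hτ 0 8 6 7 (by norm_num) (by norm_num)
    (by norm_num) (by norm_num)
    [(0, 9, certNine_0),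
      (9, 9, certNine_1),
      (18, 9, certNine_2),
      (27, 9, certNine_3),
      (36, 10, certNine_4),
      (46, 9, certNine_5),
      (55, 10, certNine_6),
      (65, 10, certNine_7),
      (75, 10, certNine_8),
      (85, 9, certNine_9),
      (94, 10, certNine_10),
      (104, 11, certNine_11),
      (115, 11, certNine_12),
      (126, 10, certNine_13),
      (136, 10, certNine_14),
      (146, 10, certNine_15),
      (156, 10, certNine_16),
      (166, 10, certNine_17),
      (176, 0, certNine_18)] ?_ ?_
  · rw [hv]
    simp only [List.forall_mem_cons]
    refine ⟨runNine_0, runNine_1, runNine_2, runNine_3, runNine_4, runNine_5, runNine_6, runNine_7, runNine_8, runNine_9, runNine_10, runNine_11, runNine_12, runNine_13, runNine_14, runNine_15, runNine_16, runNine_17, runNine_18, ?_⟩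
    simp
  · intro x
    simp
    omega

/-- certificate -/
def certFiveFour_0 : ℕ :=
  5796479477026864317775738522330794615449972709823403484304038832588920770387646000916963071867758413922153667169659265729187132256259823404075411469663194288353970880307646293036623759476533684028288421994398945352832391847731555991869723864521985738669293483599753971716543407680097617566459568887291420184760622055054378491006696157023123621958185360926229048636448468580507811326008468295860138604073258089285724582564298898855916817264492512444344027344671147700458860513530994398257058668664636652052443631451253333396401821726478432902398010201312998136412682404477037978538836390494896125992446807593040505811967397703682686445514339299267970016073092477732437102185072819107001683367590679339135520412035043546020846365858149149526013336600801566779045559118841448949996064134446800850739753043486695735731747463000327707100017729727422501699002311569200799365200191494668551834750881363277264084603967099356275294579509006400494330825415869119078029966226357917571734947382322026290868153572731552474667148742166794400691219045333447207953081684276362276526340396571845457749506310170518386938306474321263837830789852771583085456519963543524789172548766088911582757093014921661512116783025046470569300183800500008439727509634705297626356812378089561447666237987334281135123808201679897469603738244797031055741852158578256256935182562617412395899136246538293966809126781672430743098615301722799506569632553128302385480297830456090382480768807828476645943197258578177652612517826077068014551203776242859753770070304939763914235662240893580056883383582723012397982850790987029443272282310521575045980462120853409645116729024956815783021060123455147897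51956927849594983639108701738076527722615958952072257766613610705254167643510559692250269813213765331836629990663068811457327949559444121506081306768765728538591610727299685705114716192956237127875884269366891199229295201

theorem runFiveFour_0 : crun 9 okNotNine [1, 2, 3, 4, 0, 6, 7, 8, 5] 5 6 8 7 0 0
    certFiveFour_0 = true := by
  decide +kernel

theorem noFiveFour (S : Set (Equiv.Perm (Fin 9))) (hS : GoodS 9 S)
    (hok : ∀ σ ∈ S, okNotNine (vals σ) = true) (τ : Equiv.Perm (Fin 9)) (hτ : τ ∈ S)
    (hv : vals τ = [1, 2, 3, 4, 0, 6, 7, 8, 5]) : False := by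
  refine crun_spec (by norm_num) S hS _ hok τ hτ 5 6 8 7 (by norm_num) (by norm_num)
    (by norm_num) (by norm_num)
    [(0, 0, certFiveFour_0)] ?_ ?_
  · rw [hv]
    simp only [List.forall_mem_cons]
    refine ⟨runFiveFour_0, ?_⟩
    simp
  · intro x
    simp

/-- certificate -/
def certSixThree_0 : ℕ :=
  3994273513105893125498215384866214333563481682607730178252114836840981785698038309038884763277345310759420440145700791079544855525787144209667157478886468317180548518854270001673961249101911155874458559369338380696046180677754403202133643998983693020648560179174462719059651799865097950861369523033943535937820644387534961632828648105359308645012236790116580933896367725617675011380187116693497138811000192295744298266427653934095806541769722547134652282190192942279812824580575834821630184568354072476031569723647981611373299277769914490673235596752314891114514742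

theorem runSixThree_0 : crun 9 (okPow 6) [1, 2, 3, 4, 5, 0, 7, 8, 6] 0 5 3 4 0 0
    certSixThree_0 = true := by
  decide +kernel

theorem noSixThree (S : Set (Equiv.Perm (Fin 9))) (hS : GoodS 9 S)
    (hok : ∀ σ ∈ S, (okPow 6) (vals σ) = true) (τ : Equiv.Perm (Fin 9)) (hτ : τ ∈ S)
    (hv : vals τ = [1, 2, 3, 4, 5, 0, 7, 8, 6]) : False := by
  refine crun_spec (by norm_num) S hS _ hok τ hτ 0 5 3 4 (by norm_num) (by norm_num)
    (by norm_num) (by norm_num)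
    [(0, 0, certSixThree_0)] ?_ ?_
  · rw [hv]
    simp only [List.forall_mem_cons]
    refine ⟨runSixThree_0, ?_⟩
    simp
  · intro x
    simp

/-- certificate -/
def certThreeThreeThree_0 : ℕ :=
  1770453466383031761184843010866221881021775087846408971619605877599431517468268614234710786711387809500198001388810885247994443116035492155936151863794019081108

theorem runThreeThreeThree_0 : crun 9 (okPow 3) [1, 2, 0, 4, 5, 3, 7, 8, 6] 3 5 7 8 0 0
    certThreeThreeThree_0 = true := by
  decide +kernel

theorem noThreeThreeThree (S : Set (Equiv.Perm (Fin 9))) (hS : GoodS 9 S)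
    (hok : ∀ σ ∈ S, (okPow 3) (vals σ) = true) (τ : Equiv.Perm (Fin 9)) (hτ : τ ∈ S)
    (hv : vals τ = [1, 2, 0, 4, 5, 3, 7, 8, 6]) : False := by
  refine crun_spec (by norm_num) S hS _ hok τ hτ 3 5 7 8 (by norm_num) (by norm_num)
    (by norm_num) (by norm_num)
    [(0, 0, certThreeThreeThree_0)] ?_ ?_
  · rw [hv]
    simp only [List.forall_mem_cons]
    refine ⟨runThreeThreeThree_0, ?_⟩
    simp
  · intro x
    simp

theorem lget_eq (s : List ℕ) (n : ℕ) : lget s n = s.getD n 0 := by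
  induction s generalizing n with
  | nil => rfl
  | cons x xs ih =>
    cases n with
    | zero => rfl
    | succ n => exact ih n

theorem lpow_vals {K : ℕ} (σ : Equiv.Perm (Fin K)) (x : Fin K) (n : ℕ) :
    lpow (vals σ) x n = ((σ ^ n) x : Fin K) := by
  induction n with
  | zero => rfl
  | succ n ih =>
    change lget (vals σ) (lpow (vals σ) x n) = _
    rw [ih, lget_eq, vals, pow_succ', Equiv.Perm.mul_apply]
    simp [List.getD, sv]

theorem okPow_vals {K : ℕ} (σ : Equiv.Perm (Fin K)) (m : ℕ) (h : σ ^ m = 1) :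
    okPow m (vals σ) = true := by
  have key : ∀ (s l : List ℕ), (∀ x ∈ l, lpow s x m = x) →
      (List.rec true (fun x _ ih => Bool.rec false ih (Nat.beq (lpow s x m) x)) l : Bool) = true := by
    intro s l hl
    induction l with
    | nil => rfl
    | cons x xs ih =>
      simp only [List.forall_mem_cons] at hl
      have h1 : Nat.beq (lpow s x m) x = true := by rw [Nat.beq_eq, hl.1]
      change (Bool.rec false _ (Nat.beq (lpow s x m) x) : Bool) = true
      rw [h1]
      exact ih hl.2
  apply key
  intro x hx
  rw [vals, List.mem_map] at hx
  obtain ⟨p, hp, rfl⟩ := hx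
  rw [List.mem_range] at hp
  have := lpow_vals σ ⟨sv σ p, sv_lt (by omega) _ _⟩ m
  simpa [h] using this

theorem GoodS.conj {K : ℕ} {S : Set (Equiv.Perm (Fin K))} (hS : GoodS K S)
    (e : Equiv.Perm (Fin K)) : GoodS K {σ | e⁻¹ * σ * e ∈ S} := by
  have ap : ∀ σ : Equiv.Perm (Fin K), ∀ i, (e⁻¹ * σ * e) i = e⁻¹ (σ (e i)) := fun _ _ => rfl
  have cancel : ∀ σ τ : Equiv.Perm (Fin K), e⁻¹ * σ * e = e⁻¹ * τ * e → σ = τ := by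
    intro σ τ h
    simpa using h
  constructor
  · intro σ hσ
    have := hS.inv _ hσ
    simpa [mul_assoc] using this
  · intro σ hσ i h
    apply hS.ne _ hσ (e⁻¹ i)
    simp [h]
  · intro σ hσ i h
    apply hS.ne2 _ hσ (e⁻¹ i)
    simp [h]
  · intro σ hσ τ hτ h1 h2
    obtain ⟨i, hi⟩ := hS.agree _ hσ _ hτ (fun h => h1 (cancel _ _ h)) (fun h => h2 (by
      apply cancel; rw [h]; simp [mul_assoc]))
    exact ⟨e i, by simpa using hi⟩
  · intro σ hσ τ hτ i j h1 h2 h3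
    have := hS.uniq _ hσ _ hτ (e⁻¹ i) (e⁻¹ j) (fun h => h1 (cancel _ _ h)) (by simp [h2])
      (by simp [h3])
    simpa using this
  · intro i j k l h1 h2 h3 h4 h5
    obtain ⟨σ, hσ, e1, e2⟩ := hS.ex (e⁻¹ i) (e⁻¹ j) (e⁻¹ k) (e⁻¹ l) (by simpa using h1)
      (by simpa using h2) (by simpa using h3) (by simpa using h4) (by simpa using h5)
    refine ⟨e * σ * e⁻¹, ?_, ?_, ?_⟩
    · simpa [mul_assoc] using hσ
    · change e (σ (e⁻¹ i)) = j
      rw [e1]; simp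
    · change e (σ (e⁻¹ k)) = l
      rw [e2]; simp

/-- If `S` contains a permutation of the cycle type of `ρ` we may relabel to have `ρ ∈ S`. -/
theorem GoodS.relabel {K : ℕ} {S : Set (Equiv.Perm (Fin K))} (hS : GoodS K S)
    (σ ρ : Equiv.Perm (Fin K)) (hσ : σ ∈ S) (h : σ.cycleType = ρ.cycleType) :
    ∃ S', GoodS K S' ∧ ρ ∈ S' ∧ ∀ τ' ∈ S', ∃ τ ∈ S, τ'.cycleType = τ.cycleType := by
  obtain ⟨e, he⟩ := isConj_iff.1 (Equiv.Perm.isConj_iff_cycleType_eq.2 h)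
  refine ⟨_, hS.conj e, ?_, ?_⟩
  · change e⁻¹ * ρ * e ∈ S
    rw [← he]
    simpa [mul_assoc] using hσ
  · intro τ' hτ'
    refine ⟨_, hτ', ?_⟩
    have := Equiv.Perm.cycleType_conj (σ := τ') (τ := e⁻¹)
    rw [inv_inv] at this
    exact this.symm

theorem cycleType_props {K : ℕ} {S : Set (Equiv.Perm (Fin K))} (hS : GoodS K S)
    (σ : Equiv.Perm (Fin K)) (hσ : σ ∈ S) :
    σ.cycleType.sum = K ∧ ∀ n ∈ σ.cycleType, 3 ≤ n := by
  constructor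
  · rw [Equiv.Perm.sum_cycleType]
    have : σ.support = Finset.univ := by
      ext i; simp [hS.ne σ hσ i]
    rw [this]; simp
  · intro n hn
    have h2 := Equiv.Perm.two_le_of_mem_cycleType hn
    by_contra hlt
    have : n = 2 := by omega
    subst this
    rw [Equiv.Perm.mem_cycleType_iff] at hn
    obtain ⟨c, τ, rfl, hd, hc, hcard⟩ := hn
    obtain ⟨x, hx⟩ := hc.nonempty_support
    apply hS.ne2 _ hσ x
    have ho : orderOf c = 2 := by rw [hc.orderOf, hcard]
    have hc2 : c ^ 2 = 1 := by rw [← ho]; exact pow_orderOf_eq_one c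
    have hx' : c x ∈ c.support := by simpa using hx
    have t1 : τ x = x := by
      rcases hd x with h | h
      · exact absurd h (by simpa using hx)
      · exact h
    have t2 : τ (c x) = c x := by
      rcases hd (c x) with h | h
      · exact absurd h (by simpa using hx)
      · exact h
    have : (c ^ 2) x = x := by rw [hc2]; rfl
    rw [pow_two] at this
    simpa [t1, t2] using this

theorem multiset_six (m : Multiset ℕ) (hs : m.sum = 6) (h : ∀ n ∈ m, 3 ≤ n) :
    m = {6} ∨ m = {3, 3} := by
  induction m using Quotient.inductionOn with
  | h l =>
    simp only [Multiset.quot_mk_to_coe, Multiset.sum_coe, Multiset.mem_coe] at hs h ⊢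
    rcases l with _ | ⟨a, _ | ⟨b, _ | ⟨c, t⟩⟩⟩
    · simp at hs
    · simp at hs; subst hs; left; rfl
    · simp at hs h
      have ha : a = 3 := by omega
      have hb : b = 3 := by omega
      subst ha hb; right; rfl
    · simp at hs h; omega

theorem multiset_nine (m : Multiset ℕ) (hs : m.sum = 9) (h : ∀ n ∈ m, 3 ≤ n) :
    m = {9} ∨ m = {5, 4} ∨ m = {6, 3} ∨ m = {3, 3, 3} := by
  induction m using Quotient.inductionOn with
  | h l =>
    simp only [Multiset.quot_mk_to_coe, Multiset.sum_coe, Multiset.mem_coe] at hs h ⊢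
    rcases l with _ | ⟨a, _ | ⟨b, _ | ⟨c, _ | ⟨d, t⟩⟩⟩⟩
    · simp at hs
    · simp at hs; subst hs; left; rfl
    · simp at hs h
      have hab : (a = 3 ∧ b = 6) ∨ (a = 4 ∧ b = 5) ∨ (a = 5 ∧ b = 4) ∨ (a = 6 ∧ b = 3) := by omega
      rcases hab with ⟨rfl, rfl⟩ | ⟨rfl, rfl⟩ | ⟨rfl, rfl⟩ | ⟨rfl, rfl⟩ <;> decide
    · simp at hs h
      have ha : a = 3 := by omega
      have hb : b = 3 := by omega
      have hc : c = 3 := by omega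
      subst ha hb hc; right; right; right; rfl
    · simp at hs h; omega

def rho6 : Equiv.Perm (Fin 6) := ⟨![1, 2, 3, 4, 5, 0], ![5, 0, 1, 2, 3, 4], by decide, by decide⟩
def rho33 : Equiv.Perm (Fin 6) := ⟨![1, 2, 0, 4, 5, 3], ![2, 0, 1, 5, 3, 4], by decide, by decide⟩
def rho9 : Equiv.Perm (Fin 9) :=
  ⟨![1, 2, 3, 4, 5, 6, 7, 8, 0], ![8, 0, 1, 2, 3, 4, 5, 6, 7], by decide, by decide⟩
def rho54 : Equiv.Perm (Fin 9) :=
  ⟨![1, 2, 3, 4, 0, 6, 7, 8, 5], ![4, 0, 1, 2, 3, 8, 5, 6, 7], by decide, by decide⟩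
def rho63 : Equiv.Perm (Fin 9) :=
  ⟨![1, 2, 3, 4, 5, 0, 7, 8, 6], ![5, 0, 1, 2, 3, 4, 8, 6, 7], by decide, by decide⟩
def rho333 : Equiv.Perm (Fin 9) :=
  ⟨![1, 2, 0, 4, 5, 3, 7, 8, 6], ![2, 0, 1, 5, 3, 4, 8, 6, 7], by decide, by decide⟩

theorem ct6 : rho6.cycleType = {6} := by decide +kernel
theorem ct33 : rho33.cycleType = {3, 3} := by decide +kernel
theorem ct9 : rho9.cycleType = {9} := by decide +kernel
theorem ct54 : rho54.cycleType = {5, 4} := by decide +kernel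
theorem ct63 : rho63.cycleType = {6, 3} := by decide +kernel
theorem ct333 : rho333.cycleType = {3, 3, 3} := by decide +kernel

theorem pow_of_cycleType {K : ℕ} (σ : Equiv.Perm (Fin K)) (m : ℕ)
    (h : ∀ n ∈ σ.cycleType, n ∣ m) : σ ^ m = 1 := by
  rw [← orderOf_dvd_iff_pow_eq_one, ← Equiv.Perm.lcm_cycleType]
  exact Multiset.lcm_dvd.2 h

theorem okNotNine_vals (σ : Equiv.Perm (Fin 9)) (hne : ∀ i, σ i ≠ i)
    (h : σ ^ 20 = 1 ∨ σ ^ 6 = 1) : okNotNine (vals σ) = true := by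
  unfold okNotNine
  rw [boolrec_ite]
  split
  · rfl
  · rename_i h3
    rw [Nat.beq_eq] at h3
    rw [Bool.not_eq_true', nbeq_false]
    have e3 := lpow_vals σ 0 3
    have e9 := lpow_vals σ 0 9
    simp only [Fin.val_zero] at e3 e9
    intro h9
    rw [e9] at h9
    rw [e3] at h3
    have f9 : (σ ^ 9) 0 = 0 := Fin.ext h9
    rcases h with h | h
    · apply hne 0
      have f81 : ((σ ^ 9) ^ 9) 0 = 0 := by
        have := Equiv.Perm.pow_apply_eq_self_of_apply_eq_self f9 9
        exact this
      have : (σ ^ 9) ^ 9 = σ := by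
        rw [← pow_mul, show 9 * 9 = 20 * 4 + 1 by norm_num, pow_succ, pow_mul, h]; simp
      rwa [this] at f81
    · apply h3
      have : σ ^ 9 = σ ^ 3 := by
        have h63 := pow_add σ 6 3
        rw [h, one_mul] at h63
        exact h63
      rw [← this, f9]; rfl

theorem GoodS.not_six {S : Set (Equiv.Perm (Fin 6))} (hS : GoodS 6 S) : False := by
  have key : ∀ {S : Set (Equiv.Perm (Fin 6))}, GoodS 6 S → ∀ σ ∈ S,
      σ.cycleType = {6} ∨ σ.cycleType = {3, 3} := by
    intro S hS σ hσ
    obtain ⟨h1, h2⟩ := cycleType_props hS σ hσ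
    exact multiset_six _ h1 h2
  have no6 : ∀ {S : Set (Equiv.Perm (Fin 6))}, GoodS 6 S → ∀ σ ∈ S, σ.cycleType ≠ {6} := by
    intro S hS σ hσ h
    obtain ⟨S', hS', hρ, -⟩ := hS.relabel σ rho6 hσ (h.trans ct6.symm)
    exact noSix S' hS' (fun _ _ => rfl) rho6 hρ (by decide)
  have no33 : ∀ σ ∈ S, σ.cycleType ≠ {3, 3} := by
    intro σ hσ h
    obtain ⟨S', hS', hρ, -⟩ := hS.relabel σ rho33 hσ (h.trans ct33.symm)
    refine noThreeThree S' hS' (fun τ hτ => okPow_vals _ _ (pow_of_cycleType _ _ ?_)) rho33 hρ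
      (by decide)
    rcases key hS' τ hτ with h | h
    · exact absurd h (no6 hS' τ hτ)
    · rw [h]; decide
  obtain ⟨σ, hσ, -⟩ := hS.ex 0 1 1 2 (by decide) (by decide) (by decide) (by decide) (by decide)
  rcases key hS σ hσ with h | h
  · exact no6 hS σ hσ h
  · exact no33 σ hσ h

theorem GoodS.not_nine {S : Set (Equiv.Perm (Fin 9))} (hS : GoodS 9 S) : False := by
  have key : ∀ {S : Set (Equiv.Perm (Fin 9))}, GoodS 9 S → ∀ σ ∈ S,
      σ.cycleType = {9} ∨ σ.cycleType = {5, 4} ∨ σ.cycleType = {6, 3} ∨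
        σ.cycleType = {3, 3, 3} := by
    intro S hS σ hσ
    obtain ⟨h1, h2⟩ := cycleType_props hS σ hσ
    exact multiset_nine _ h1 h2
  have no9 : ∀ {S : Set (Equiv.Perm (Fin 9))}, GoodS 9 S → ∀ σ ∈ S, σ.cycleType ≠ {9} := by
    intro S hS σ hσ h
    obtain ⟨S', hS', hρ, -⟩ := hS.relabel σ rho9 hσ (h.trans ct9.symm)
    exact noNine S' hS' (fun _ _ => rfl) rho9 hρ (by decide)
  have no54 : ∀ {S : Set (Equiv.Perm (Fin 9))}, GoodS 9 S → ∀ σ ∈ S, σ.cycleType ≠ {5, 4} := by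
    intro S hS σ hσ h
    obtain ⟨S', hS', hρ, -⟩ := hS.relabel σ rho54 hσ (h.trans ct54.symm)
    refine noFiveFour S' hS' (fun τ hτ => okNotNine_vals _ (hS'.ne τ hτ) ?_) rho54 hρ (by decide)
    rcases key hS' τ hτ with h | h | h | h
    · exact absurd h (no9 hS' τ hτ)
    · left; apply pow_of_cycleType; rw [h]; decide
    · right; apply pow_of_cycleType; rw [h]; decide
    · right; apply pow_of_cycleType; rw [h]; decide
  have no63 : ∀ {S : Set (Equiv.Perm (Fin 9))}, GoodS 9 S → ∀ σ ∈ S, σ.cycleType ≠ {6, 3} := by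
    intro S hS σ hσ h
    obtain ⟨S', hS', hρ, -⟩ := hS.relabel σ rho63 hσ (h.trans ct63.symm)
    refine noSixThree S' hS' (fun τ hτ => okPow_vals _ _ (pow_of_cycleType _ _ ?_)) rho63 hρ
      (by decide)
    rcases key hS' τ hτ with h | h | h | h
    · exact absurd h (no9 hS' τ hτ)
    · exact absurd h (no54 hS' τ hτ)
    · rw [h]; decide
    · rw [h]; decide
  have no333 : ∀ σ ∈ S, σ.cycleType ≠ {3, 3, 3} := by
    intro σ hσ h
    obtain ⟨S', hS', hρ, -⟩ := hS.relabel σ rho333 hσ (h.trans ct333.symm)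
    refine noThreeThreeThree S' hS' (fun τ hτ => okPow_vals _ _ (pow_of_cycleType _ _ ?_)) rho333 hρ
      (by decide)
    rcases key hS' τ hτ with h | h | h | h
    · exact absurd h (no9 hS' τ hτ)
    · exact absurd h (no54 hS' τ hτ)
    · exact absurd h (no63 hS' τ hτ)
    · rw [h]; decide
  obtain ⟨σ, hσ, -⟩ := hS.ex 0 1 1 2 (by decide) (by decide) (by decide) (by decide) (by decide)
  rcases key hS σ hσ with h | h | h | h
  · exact no9 hS σ hσ h
  · exact no54 hS σ hσ h
  · exact no63 hS σ hσ h
  · exact no333 σ hσ h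

/-- Configuration of deficiency one, with its antipodal maps on rows and columns. -/
structure Cfg {α β : Type} (M : α → β → Prop) (t : α → α) (q : β → β) : Prop where
  nr : ∀ i i' j j', M i j → M i j' → M i' j → M i' j' → i ≠ i' → j = j'
  tne : ∀ i, t i ≠ i
  tdisj : ∀ i j, M i j → ¬ M (t i) j
  meet : ∀ i i', i' ≠ i → i' ≠ t i → ∃ j, M i j ∧ M i' j
  qne : ∀ j, q j ≠ j
  qdisj : ∀ i j, M i j → ¬ M i (q j)
  join : ∀ j j', j' ≠ j → j' ≠ q j → ∃ i, M i j ∧ M i j'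
  tt : ∀ i, t (t i) = i
  qq : ∀ j, q (q j) = j
  aut : ∀ i j, M i j → M (t i) (q j)

theorem IsIncidence.transpose {α β : Type} [Fintype α] [Fintype β] {k : ℕ} {M : α → β → Bool}
    (h : IsIncidence k M) : IsIncidence k (fun j i => M i j) := by
  refine ⟨h.2.1, h.1, ?_⟩
  intro i₁ i₂ j₁ j₂ hi hj a b c d
  exact h.2.2 j₁ j₂ i₁ i₂ hj hi a c b d

theorem exists_antipode {α β : Type} [Fintype α] [Fintype β] [DecidableEq α] {k : ℕ}
    {M : α → β → Bool} (h : IsIncidence k M) (hc : Fintype.card α = k ^ 2 - k + 2) (i : α) :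
    ∃ i', i' ≠ i ∧ (∀ j, M i j = true → ¬ M i' j = true) ∧
      ∀ i'', i'' ≠ i → i'' ≠ i' → ∃ j, M i j = true ∧ M i'' j = true := by
  classical
  set N : Finset α := (Finset.univ.filter (fun j => M i j = true)).biUnion
    (fun j => (Finset.univ.filter (fun i' => M i' j = true)).erase i) with hN
  have hcard : N.card = k * (k - 1) := by
    rw [hN, Finset.card_biUnion]
    · rw [Finset.sum_const_nat (m := k - 1), h.1 i]
      intro j hj
      rw [Finset.card_erase_of_mem, h.2.1 j]
      simpa using hj
    · intro j hj j' hj' hne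
      rw [Function.onFun, Finset.disjoint_left]
      intro a ha ha'
      simp at ha ha' hj hj'
      exact h.2.2 i a j j' (Ne.symm ha.1) hne hj hj' ha.2 ha'.2
  have hi : i ∉ N := by simp [hN]
  have h1 : (insert i N)ᶜ.card = 1 := by
    rw [Finset.card_compl, Finset.card_insert_of_notMem hi, hcard, hc, Nat.mul_sub, mul_one, pow_two]
    omega
  obtain ⟨i', hi'⟩ := Finset.card_eq_one.1 h1
  have mem : ∀ x, x ∈ (insert i N)ᶜ ↔ x = i' := by intro x; rw [hi']; simp
  have memN : ∀ x, x ∈ N ↔ x ≠ i ∧ ∃ j, M i j = true ∧ M x j = true := by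
    intro x
    simp only [hN, Finset.mem_biUnion, Finset.mem_filter, Finset.mem_univ, true_and,
      Finset.mem_erase]
    constructor
    · rintro ⟨j, a, b, c⟩; exact ⟨b, j, a, c⟩
    · rintro ⟨b, j, a, c⟩; exact ⟨j, a, b, c⟩
  have m' := (mem i').2 rfl
  rw [Finset.mem_compl, Finset.mem_insert, not_or, memN] at m'
  refine ⟨i', m'.1, ?_, ?_⟩
  · intro j a b
    exact m'.2 ⟨m'.1, j, a, b⟩
  · intro x hx hx'
    have : x ∉ (insert i N)ᶜ := fun hh => hx' ((mem x).1 hh)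
    rw [Finset.mem_compl, not_not, Finset.mem_insert, memN] at this
    rcases this with h | h
    · exact absurd h hx
    · exact h.2

theorem exists_cfg {α β : Type} [Fintype α] [Fintype β] [DecidableEq α] [DecidableEq β] {k : ℕ}
    {M : α → β → Bool} (h : IsIncidence k M) (hc : Fintype.card α = k ^ 2 - k + 2)
    (hc' : Fintype.card β = k ^ 2 - k + 2) :
    ∃ t q, Cfg (fun i j => M i j = true) t q := by
  choose t t1 t2 t3 using exists_antipode h hc
  choose q q1 q2 q3 using exists_antipode h.transpose hc'
  refine ⟨t, q, ?_⟩
  have tt : ∀ i, t (t i) = i := by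
    intro i
    by_contra hne
    obtain ⟨j, a, b⟩ := t3 (t i) i (t1 i).symm (Ne.symm hne)
    exact t2 i j b a
  have qq : ∀ i, q (q i) = i := by
    intro i
    by_contra hne
    obtain ⟨j, a, b⟩ := q3 (q i) i (q1 i).symm (Ne.symm hne)
    exact q2 i j b a
  refine ⟨?_, t1, t2, t3, q1, fun i j => q2 j i, q3, tt, qq, ?_⟩
  · intro i i' j j' a b c d hne
    by_contra hj
    exact h.2.2 i i' j j' hne hj a b c d
  · intro i j hij
    by_contra hno
    have hj : ¬ M (t i) j = true := t2 i j hij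
    have ex : ∀ c, M (t i) c = true → ∃ r, M r j = true ∧ M r c = true := by
      intro c hc
      apply q3 j c
      · rintro rfl; exact hj hc
      · rintro rfl; exact hno hc
    have : Nonempty α := ⟨i⟩
    choose! r r1 r2 using ex
    have hle : (Finset.univ.filter (fun c => M (t i) c = true)).card ≤
        ((Finset.univ.filter (fun r => M r j = true)).erase i).card := by
      apply Finset.card_le_card_of_injOn r
      · intro c hc
        simp at hc ⊢
        refine ⟨r1 c hc, ?_⟩
        intro he
        have := r2 c hc
        rw [he] at this
        exact t2 i c this hc
      · intro c hc c' hc' he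
        simp at hc hc'
        by_contra hne
        refine h.2.2 (r c) (t i) c c' ?_ hne (r2 c hc) (he ▸ r2 c' hc') hc hc'
        intro e
        exact hj (e ▸ r1 c hc)
    have him : i ∈ Finset.univ.filter (fun r => M r j = true) := by simpa using hij
    rw [Finset.card_erase_of_mem him, h.1, h.2.1] at hle
    have : 0 < k := by
      rw [← h.2.1 j]; exact Finset.card_pos.2 ⟨i, him⟩
    omega

/-! ### The permutation set -/

section perms

variable {α β : Type} {M : α → β → Prop} {t : α → α} {q : β → β}

theorem Cfg.rowEq (h : Cfg M t q) {i i' j j'} (a : M i j) (b : M i j') (c : M i' j)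
    (d : M i' j') (hne : j ≠ j') : i = i' := by
  by_contra hi
  exact hne (h.nr i i' j j' a b c d hi)

/-- the relation attached to the point `p` -/
def pRel (M : α → β → Prop) (q : β → β) {K : ℕ} (x : Fin K → β) (p : β) (i j : Fin K) : Prop :=
  ∃ m, M m p ∧ M m (x i) ∧ M m (q (x j))

/-- The set of permutations read off from the points outside `L` and its antipode. -/
def permSet (M : α → β → Prop) (t : α → α) (q : β → β) (L : α) {K : ℕ} (x : Fin K → β) :
    Set (Equiv.Perm (Fin K)) :=
  {σ | ∃ p, ¬ M L p ∧ ¬ M (t L) p ∧ ∀ i, pRel M q x p i (σ i)}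

theorem Cfg.goodS (h : Cfg M t q) (L : α) {K : ℕ} (x : Fin K → β) (hx : Function.Injective x)
    (hL : ∀ j, M L j ↔ ∃ i, x i = j) : GoodS K (permSet M t q L x) := by
  have Lx : ∀ i, M L (x i) := fun i => (hL _).2 ⟨i, rfl⟩
  have tLx : ∀ i, M (t L) (q (x i)) := fun i => h.aut _ _ (Lx i)
  have tL : ∀ j, M (t L) j → ∃ i, q (x i) = j := by
    intro j hj
    have := h.aut _ _ hj
    rw [h.tt] at this
    obtain ⟨i, hi⟩ := (hL _).1 this
    exact ⟨i, by rw [hi, h.qq]⟩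
  have qinj : Function.Injective q := fun a b hab => by rw [← h.qq a, hab, h.qq]
  have nLq : ∀ i, ¬ M L (q (x i)) := fun i => h.qdisj _ _ (Lx i)
  have ntL : ∀ i, ¬ M (t L) (x i) := fun i => h.tdisj _ _ (Lx i)
  -- functionality
  have fn : ∀ p, ¬ M L p → ¬ M (t L) p → ∀ i j j', pRel M q x p i j → pRel M q x p i j' →
      j = j' := by
    rintro p p1 p2 i j j' ⟨m, a, b, c⟩ ⟨m', a', b', c'⟩
    have hpx : p ≠ x i := by rintro rfl; exact p1 (Lx i)
    have e := h.rowEq a b a' b' hpx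
    subst e
    have : m ≠ t L := by rintro rfl; exact p2 a
    exact hx (qinj (h.nr m (t L) _ _ c c' (tLx _) (tLx _) this))
  have fi : ∀ p, ¬ M L p → ¬ M (t L) p → ∀ i i' j, pRel M q x p i j → pRel M q x p i' j →
      i = i' := by
    rintro p p1 p2 i i' j ⟨m, a, b, c⟩ ⟨m', a', b', c'⟩
    have hpx : p ≠ q (x j) := by rintro rfl; exact p2 (tLx j)
    have e := h.rowEq a c a' c' hpx
    subst e
    have : m ≠ L := by rintro rfl; exact p1 a
    exact hx (h.nr m L _ _ b b' (Lx _) (Lx _) this)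
  have tot : ∀ p, ¬ M L p → ¬ M (t L) p → ∃ σ : Equiv.Perm (Fin K),
      ∀ i, pRel M q x p i (σ i) := by
    intro p p1 p2
    have : ∀ i, ∃ j, pRel M q x p i j := by
      intro i
      obtain ⟨m, a, b⟩ := h.join (x i) p (by rintro rfl; exact p1 (Lx i))
        (by rintro rfl; exact p2 (tLx i))
      obtain ⟨y, hy, hy'⟩ := h.meet (t L) m (by rintro rfl; exact p2 b)
        (by rw [h.tt]; rintro rfl; exact p1 b)
      obtain ⟨j, rfl⟩ := tL y hy
      exact ⟨j, m, b, a, hy'⟩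
    choose f hf using this
    have inj : Function.Injective f := by
      intro i i' hii
      exact fi p p1 p2 i i' _ (hf i) (hii ▸ hf i')
    exact ⟨Equiv.ofBijective f (Finite.injective_iff_bijective.1 inj), hf⟩
  constructor
  · -- inv
    rintro σ ⟨p, p1, p2, hp⟩
    refine ⟨q p, ?_, ?_, ?_⟩
    · intro hh
      have := h.aut _ _ hh
      rw [h.qq] at this; exact p2 this
    · intro hh
      have := h.aut _ _ hh
      rw [h.qq, h.tt] at this; exact p1 this
    · intro i
      obtain ⟨m, a, b, c⟩ := hp (σ⁻¹ i)
      rw [show σ (σ⁻¹ i) = i from σ.apply_symm_apply i] at c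
      refine ⟨t m, h.aut _ _ a, ?_, h.aut _ _ b⟩
      have := h.aut _ _ c
      rwa [h.qq] at this
  · -- ne
    rintro σ ⟨p, p1, p2, hp⟩ i hi
    obtain ⟨m, a, b, c⟩ := hp i
    rw [hi] at c
    exact h.qdisj _ _ b c
  · -- ne2
    rintro σ ⟨p, p1, p2, hp⟩ i hi
    obtain ⟨m, a, b, c⟩ := hp i
    obtain ⟨m', a', b', c'⟩ := hp (σ i)
    rw [hi] at c'
    have d1 := h.aut _ _ b
    have d2 := h.aut _ _ c
    rw [h.qq] at d2
    have e : m' = t m := h.rowEq b' c' d2 d1 (by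
      intro e; exact nLq i (e ▸ Lx (σ i)))
    exact h.tdisj _ _ a (e ▸ a')
  · -- agree
    rintro σ ⟨p, p1, p2, hp⟩ τ ⟨r, r1, r2, hr⟩ hne hne'
    have hpr : r ≠ p := by
      rintro rfl
      apply hne
      ext i
      rw [fn r p1 p2 i _ _ (hp i) (hr i)]
    have hpr' : r ≠ q p := by
      rintro rfl
      apply hne'
      ext i
      congr 1
      obtain ⟨m, a, b, c⟩ := hr (τ⁻¹ i)
      rw [show τ (τ⁻¹ i) = i from τ.apply_symm_apply i] at c
      refine fn p p1 p2 i _ _ (hp i) ⟨t m, ?_, ?_, h.aut _ _ b⟩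
      · have := h.aut _ _ a
        rwa [h.qq] at this
      · have := h.aut _ _ c
        rwa [h.qq] at this
    obtain ⟨m, a, b⟩ := h.join p r hpr hpr'
    have mL : m ≠ L := by rintro rfl; exact p1 a
    have mtL : m ≠ t L := by rintro rfl; exact p2 a
    obtain ⟨y, hy, hy'⟩ := h.meet L m mL mtL
    obtain ⟨i, rfl⟩ := (hL _).1 hy
    obtain ⟨z, hz, hz'⟩ := h.meet (t L) m mtL (by rw [h.tt]; exact mL)
    obtain ⟨j, rfl⟩ := tL z hz
    refine ⟨i, ?_⟩
    rw [fn p p1 p2 i _ j (hp i) ⟨m, a, hy', hz'⟩, fn r r1 r2 i _ j (hr i) ⟨m, b, hy', hz'⟩]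
  · -- uniq
    rintro σ ⟨p, p1, p2, hp⟩ τ ⟨r, r1, r2, hr⟩ i j hne ei ej
    by_contra hij
    obtain ⟨m, a, b, c⟩ := hp i
    obtain ⟨m', a', b', c'⟩ := hr i
    obtain ⟨n, d, e, f⟩ := hp j
    obtain ⟨n', d', e', f'⟩ := hr j
    rw [← ei] at c'
    rw [← ej] at f'
    have xq : ∀ i j, x i ≠ q (x j) := fun i j e => nLq j (e ▸ Lx i)
    have e1 := h.rowEq b c b' c' (xq _ _)
    have e2 := h.rowEq e f e' f' (xq _ _)
    subst e1 e2
    have mL : m ≠ L := by rintro rfl; exact p1 a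
    have mn : m ≠ n := by
      rintro rfl
      exact hij (hx (h.nr m L _ _ b e (Lx _) (Lx _) mL))
    have := h.nr m n _ _ a a' d d' mn
    subst this
    apply hne
    ext i
    rw [fn p p1 p2 i _ _ (hp i) (hr i)]
  · -- ex
    intro i j k l hik hjl hij hkl hn
    have ln : ∀ i j, i ≠ j → ∃ m, M m (x i) ∧ M m (q (x j)) := by
      intro i j hij
      refine h.join (x i) (q (x j)) (fun e => nLq j (e ▸ Lx i)) ?_
      intro e
      exact hij (hx (qinj e)).symm
    have mL : ∀ m j, M m (q (x j)) → m ≠ L := by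
      rintro m j hm rfl; exact nLq j hm
    have mtL : ∀ m j, M m (x j) → m ≠ t L := by
      rintro m j hm rfl; exact ntL j hm
    have u1 : ∀ m i i' j, M m (q (x j)) → M m (x i) → M m (x i') → i = i' := by
      intro m i i' j a b c
      exact hx (h.nr m L _ _ b c (Lx _) (Lx _) (mL m j a))
    have u2 : ∀ m i i' j, M m (x j) → M m (q (x i)) → M m (q (x i')) → i = i' := by
      intro m i i' j a b c
      exact hx (qinj (h.nr m (t L) _ _ b c (tLx _) (tLx _) (mtL m j a)))
    obtain ⟨m, a, b⟩ := ln i j hij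
    obtain ⟨n, c, d⟩ := ln k l hkl
    have hmn : n ≠ m := by
      rintro rfl; exact hik (u1 n i k j b a c)
    have hmn' : n ≠ t m := by
      rintro rfl
      have a' := h.aut _ _ a
      have b' := h.aut _ _ b
      rw [h.qq] at b'
      exact hn ⟨u1 _ _ _ _ d c b', u2 _ _ _ _ c d a'⟩
    obtain ⟨p, hp, hp'⟩ := h.meet m n hmn hmn'
    have p1 : ¬ M L p := by
      intro hh
      obtain ⟨s, rfl⟩ := (hL _).1 hh
      exact hik ((u1 _ _ _ _ b a hp).trans (u1 _ _ _ _ d c hp').symm)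
    have p2 : ¬ M (t L) p := by
      intro hh
      obtain ⟨s, rfl⟩ := tL _ hh
      exact hjl ((u2 _ _ _ _ a b hp).trans (u2 _ _ _ _ c d hp').symm)
    obtain ⟨σ, hσ⟩ := tot p p1 p2
    exact ⟨σ, ⟨p, p1, p2, hσ⟩, fn p p1 p2 i _ _ (hσ i) ⟨m, hp, a, b⟩,
      fn p p1 p2 k _ _ (hσ k) ⟨n, hp', c, d⟩⟩

end perms

theorem IsIncidence.exists_goodS {α β : Type} [Fintype α] [Fintype β] [DecidableEq α]
    [DecidableEq β] {k : ℕ}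
    {M : α → β → Bool} (h : IsIncidence k M) (hc : Fintype.card α = k ^ 2 - k + 2)
    (hc' : Fintype.card β = k ^ 2 - k + 2) : ∃ S, GoodS k S := by
  obtain ⟨t, q, hC⟩ := exists_cfg h hc hc'
  have : 0 < Fintype.card α := by omega
  obtain ⟨L⟩ := Fintype.card_pos_iff.1 this
  let e := (Finset.univ.filter (fun j => M L j = true)).equivFinOfCardEq (h.1 L)
  refine ⟨_, hC.goodS L (fun i => (e.symm i : β)) ?_ ?_⟩
  · intro a b hab
    exact e.symm.injective (Subtype.ext hab)
  · intro j
    constructor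
    · intro hj
      exact ⟨e ⟨j, by simpa using hj⟩, by simp⟩
    · rintro ⟨i, rfl⟩
      exact (Finset.mem_filter.1 (e.symm i).2).2

/-! ### The determinant argument -/

theorem sum_involution {n : ℕ} (t : Fin n → Fin n) (tt : ∀ i, t (t i) = i) (tne : ∀ i, t i ≠ i)
    (f : Fin n → ℚ) : ∑ x, f x = ∑ x : {x // x < t x}, (f x + f (t x)) := by
  rw [Finset.sum_add_distrib]
  rw [← Fintype.sum_subtype_add_sum_subtype (fun x => x < t x) f]
  congr 1
  symm
  have h1 : ∀ x : {x // x < t x}, ¬ t x < t (t x) := by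
    intro x
    rw [tt]; exact not_lt.2 x.2.le
  have h2 : ∀ x : {x // ¬ x < t x}, t x < t (t x) := by
    intro x
    rw [tt]; exact lt_of_le_of_ne (not_lt.1 x.2) (tne _)
  exact Fintype.sum_equiv
    (⟨fun x => ⟨t x, h1 x⟩, fun x => ⟨t x, h2 x⟩, fun x => Subtype.ext (tt _),
      fun x => Subtype.ext (tt _)⟩ : {x // x < t x} ≃ {x // ¬ x < t x}) _ _ (fun x => rfl)

theorem isSquare_of_mul_sq {x s d : ℚ} (hs : s ≠ 0) (h : x * s ^ 2 = d ^ 2) : IsSquare x := by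
  refine ⟨d / s, ?_⟩
  field_simp
  exact h

theorem det_scalar_add_const {R : Type} [Fintype R] [DecidableEq R] (a b : ℚ) (ha : a ≠ 0) :
    (Matrix.of fun i j : R => if i = j then a + b else b).det =
      a ^ Fintype.card R * (1 + Fintype.card R * b / a) := by
  have : (Matrix.of fun i j : R => if i = j then a + b else b) =
      a • (1 + Matrix.replicateCol Unit (fun _ : R => b / a) *
        Matrix.replicateRow Unit (fun _ : R => (1 : ℚ))) := by
    ext i j
    simp only [Matrix.of_apply, Matrix.smul_apply, Matrix.add_apply, Matrix.one_apply,
      Matrix.mul_apply, Matrix.replicateCol_apply, Matrix.replicateRow_apply]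
    split
    · simp; field_simp
    · simp; field_simp
  rw [this, Matrix.det_smul, Matrix.det_one_add_replicateCol_mul_replicateRow]
  congr 2
  simp [dotProduct]
  ring

theorem det_arg {v k : ℕ} (hk : 3 ≤ k) (hv : v = k ^ 2 - k + 2) (M : Fin v → Fin v → Bool)
    (h : IsIncidence k M) : IsSquare k ∨ IsSquare (k - 2) := by
  obtain ⟨t, q, hC⟩ := exists_cfg h (by simpa using hv) (by simpa using hv)
  set A : Fin v → Fin v → ℚ := fun i j => if M i j = true then 1 else 0 with hA
  have hAq : ∀ i j, A i (q j) = A (t i) j := by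
    intro i j
    have : M i (q j) = true ↔ M (t i) j = true := by
      constructor
      · intro hh
        have := hC.aut _ _ hh
        rwa [hC.qq] at this
      · intro hh
        have := hC.aut _ _ hh
        rwa [hC.tt] at this
    simp only [hA, this]
  have N1 : ∀ r, ∑ c, A r c * A r c = k := by
    intro r
    rw [← h.1 r, Finset.card_filter]
    push_cast
    refine Finset.sum_congr rfl fun c _ => ?_
    simp only [hA]; split <;> simp
  have N2 : ∀ r, ∑ c, A r c * A (t r) c = 0 := by
    intro r
    refine Finset.sum_eq_zero fun c _ => ?_
    have := hC.tdisj r c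
    by_cases h1 : M r c = true
    · simp only [hA, if_neg (this h1), mul_zero]
    · simp only [hA, if_neg h1, zero_mul]
  have N3 : ∀ r r', r' ≠ r → r' ≠ t r → ∑ c, A r c * A r' c = 1 := by
    intro r r' h1 h2
    obtain ⟨j, a, b⟩ := hC.meet r r' h1 h2
    rw [Finset.sum_eq_single j]
    · simp only [hA]
      rw [if_pos a, if_pos b, one_mul]
    · intro c _ hc
      by_cases a' : M r c = true
      · by_cases b' : M r' c = true
        · exact absurd (hC.nr r r' j c a a' b b' h1.symm).symm hc
        · simp only [hA, if_neg b', mul_zero]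
      · simp only [hA, if_neg a', zero_mul]
    · simp
  let R := {x // x < t x}
  let C := {x // x < q x}
  have cR : (v : ℚ) = 2 * Fintype.card R := by
    have := sum_involution t hC.tt hC.tne (fun _ => 1)
    simp at this
    rw [this]; simp only [R, Fintype.card_subtype]; ring
  have cC : (v : ℚ) = 2 * Fintype.card C := by
    have := sum_involution q hC.qq hC.qne (fun _ => 1)
    simp at this
    rw [this]; simp only [C, Fintype.card_subtype]; ring
  have cRC : Fintype.card R = Fintype.card C := by
    have : (Fintype.card R : ℚ) = Fintype.card C := by linarith
    exact_mod_cast this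
  let e : R ≃ C := Fintype.equivOfCardEq cRC
  have hR : ∀ r r' : R, r ≠ r' → (r' : Fin v) ≠ r ∧ (r' : Fin v) ≠ t r := by
    intro r r' hne
    refine ⟨fun hh => hne (Subtype.ext hh.symm), fun hh => ?_⟩
    have h1 := r.2
    have h2 := r'.2
    rw [hh, hC.tt] at h2
    exact lt_asymm h1 h2
  -- Gram matrices
  have key : ∀ (s : ℚ), s * s = 1 → ∀ r r' : R,
      ∑ c : C, (A r c + s * A r (q c)) * (A r' c + s * A r' (q c)) =
        ∑ c, A r c * A r' c + s * ∑ c, A r c * A (t r') c := by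
    intro s hs r r'
    rw [Finset.mul_sum, ← Finset.sum_add_distrib, sum_involution q hC.qq hC.qne]
    refine Finset.sum_congr rfl fun c _ => ?_
    rw [← hAq, ← hAq, hC.qq]
    linear_combination (A r (q c) * A r' (q c)) * hs
  have gram : ∀ (s : ℚ), s * s = 1 → ∃ d : ℚ, d ^ 2 =
      (Matrix.of fun i j : R => if i = j then ((k : ℚ) - (1 + s)) + (1 + s) else (1 + s)).det := by
    intro s hs
    let W : Matrix R R ℚ := Matrix.of fun r r' => A r (e r') + s * A r (q (e r'))
    refine ⟨W.det, ?_⟩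
    rw [pow_two]
    nth_rewrite 2 [← Matrix.det_transpose]
    rw [← Matrix.det_mul]
    congr 1
    ext r r'
    simp only [Matrix.mul_apply, Matrix.transpose_apply, Matrix.of_apply, W]
    rw [Equiv.sum_comp e (fun c : C => (A r c + s * A r (q c)) * (A r' c + s * A r' (q c))),
      key s hs]
    split
    · next hrr =>
      subst hrr
      rw [N1, N2]; ring
    · next hrr =>
      obtain ⟨h1, h2⟩ := hR r r' hrr
      rw [N3 _ _ h1 h2, N3]
      · ring
      · intro hh; apply h2; rw [← hh, hC.tt]
      · intro hh
        apply h1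
        rw [← hC.tt r', hh, hC.tt]
  have hkQ : (3 : ℚ) ≤ k := by exact_mod_cast hk
  have hvQ : (v : ℚ) = (k : ℚ) ^ 2 - k + 2 := by
    have : k ≤ k ^ 2 := by nlinarith
    rw [hv]; push_cast [Nat.cast_sub this]; ring
  rcases Nat.even_or_odd' (Fintype.card R) with ⟨n, hn | hn⟩
  · right
    obtain ⟨d, hd⟩ := gram 1 (by norm_num)
    rw [det_scalar_add_const _ _ (by linarith)] at hd
    have k2 : (k : ℚ) - 2 ≠ 0 := by linarith
    have k0 : (k : ℚ) ≠ 0 := by linarith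
    have hfac : (1 : ℚ) + Fintype.card R * (1 + 1) / (k - (1 + 1)) = k ^ 2 / (k - 2) := by
      have : (Fintype.card R : ℚ) = (k ^ 2 - k + 2) / 2 := by rw [← hvQ, cR]; ring
      rw [this, show (1 : ℚ) + 1 = 2 by norm_num]
      field_simp; ring
    rw [hfac, hn] at hd
    rw [← Rat.isSquare_natCast_iff, Nat.cast_sub (by omega)]
    refine isSquare_of_mul_sq (s := ((k : ℚ) - 2) ^ n * k / (k - 2)) (d := d) ?_ ?_
    · exact div_ne_zero (mul_ne_zero (pow_ne_zero _ k2) k0) k2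
    · rw [hd, show (1 : ℚ) + 1 = 2 by norm_num, pow_mul']
      push_cast
      field_simp
  · left
    obtain ⟨d, hd⟩ := gram (-1) (by norm_num)
    have k0 : (k : ℚ) ≠ 0 := by linarith
    rw [det_scalar_add_const _ _ (by simpa using k0), hn] at hd
    rw [← Rat.isSquare_natCast_iff]
    refine isSquare_of_mul_sq (s := (k : ℚ) ^ n) (d := d) (pow_ne_zero _ k0) ?_
    rw [hd]
    simp
    ring

/-- Non-existence of symmetric configurations of deficiency one: there is no
symmetric configuration `(k² - k + 2)_k` if `5 ≤ k ≤ 10`, or if `k ≥ 5` and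
neither `k` nor `k - 2` is a perfect square. -/
theorem no_deficiency_one_config (k : ℕ)
    (h : (5 ≤ k ∧ k ≤ 10) ∨ (5 ≤ k ∧ ¬IsSquare k ∧ ¬IsSquare (k - 2))) :
    ¬ConfigExists (k ^ 2 - k + 2) k := by
  rintro ⟨M, hM⟩
  have h5 : 5 ≤ k := by omega
  have hsq := det_arg (by omega) rfl M hM
  obtain ⟨S, hS⟩ := hM.exists_goodS (by simp) (by simp)
  rcases h with ⟨_, h10⟩ | ⟨_, h1, h2⟩
  · have hk : k = 6 ∨ k = 9 := by
      by_contra hk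
      have nsq : ∀ n, n ≤ 10 → IsSquare n → n = 0 ∨ n = 1 ∨ n = 4 ∨ n = 9 := by
        rintro n hn ⟨r, rfl⟩
        have : r ≤ 3 := by nlinarith
        interval_cases r <;> simp
      rcases hsq with hs | hs
      · have := nsq _ h10 hs; omega
      · have := nsq _ (by omega) hs; omega
    rcases hk with rfl | rfl
    · exact hS.not_six
    · exact hS.not_nine
  · rcases hsq with hs | hs
    · exact h1 hs
    · exact h2 hs
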